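/- arXiv:0908.1749 — 5 statements merged into one kernel-verified Lean document; each statement's English description precedes it below -/
import Mathlib

section
/- Let e ≥ 2 and r ≥ 2 be integers. The map ψ defined on ℤ∖𝟙_r by ψ(t) = a_r(t) + e(b_r(t)−2) − e(r−1)·m_r(t) is a strictly increasing bijection from ℤ∖𝟙_r onto ℤ. -/
noncomputable section

/-- The field `ℚ(q)` of rational functions. -/
abbrev K : Type := RatFunc ℚ

/-- The element `q` of `ℚ(q)`. -/
def qK : K := RatFunc.X

/-- `a_{r'}(t)`: the unique element of `{1,…,e}` congruent to `t` modulo `e`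
(this does not depend on `r'`). -/
def aFun (e t : ℤ) : ℤ := (t - 1) % e + 1

/-- `b_{r'}(t)`: the unique element of `{1,…,r'}` such that
`t = a_{r'}(t) + e (b_{r'}(t) − 1) − e r' m` for some integer `m`. -/
def bFun (e r t : ℤ) : ℤ := (t - 1) % (e * r) / e + 1

/-- `m_{r'}(t)`: the unique integer with
`t = a_{r'}(t) + e (b_{r'}(t) − 1) − e r' m_{r'}(t)`. -/
def mFun (e r t : ℤ) : ℤ := (aFun e t + e * (bFun e r t - 1) - t) / (e * r)

/-- The map `ψ(t) = a_r(t) + e(b_r(t) − 2) − e(r−1)·m_r(t)`, defined on `ℤ ∖ 𝟙_r`. -/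
def psi (e r t : ℤ) : ℤ := aFun e t + e * (bFun e r t - 2) - e * (r - 1) * mFun e r t

theorem bFun_eq_of_decomp {e r q s : ℤ} (h0 : 0 ≤ s) (h1 : s < e * r) :
    bFun e r (1 + s + e * r * q) = s / e + 1 := by
  have h : 1 + s + e * r * q - 1 = s + e * r * q := by ring
  rw [bFun, h, Int.add_mul_emod_self_left, Int.emod_eq_of_lt h0 h1]

theorem psi_eq_of_decomp {e r q s : ℤ} (h0 : 0 ≤ s) (h1 : s < e * r) :
    psi e r (1 + s + e * r * q) = 1 + (s - e) + e * (r - 1) * q := by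
  have ha : aFun e (1 + s + e * r * q) = s % e + 1 := by
    have h : 1 + s + e * r * q - 1 = s + e * (r * q) := by ring
    rw [aFun, h, Int.add_mul_emod_self_left]
  have hs := Int.emod_add_mul_ediv s e
  have hm : mFun e r (1 + s + e * r * q) = -q := by
    rw [mFun, ha, bFun_eq_of_decomp h0 h1]
    have h : s % e + 1 + e * (s / e + 1 - 1) - (1 + s + e * r * q) = e * r * -q := by
      linear_combination hs
    rw [h, Int.mul_ediv_cancel_left _ (h0.trans_lt h1).ne']
  rw [psi, ha, hm, bFun_eq_of_decomp h0 h1]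
  linear_combination hs

theorem bFun_ne_one_iff_of_decomp {e r q s : ℤ} (he : 0 < e) (h0 : 0 ≤ s) (h1 : s < e * r) :
    bFun e r (1 + s + e * r * q) ≠ 1 ↔ e ≤ s := by
  rw [bFun_eq_of_decomp h0 h1]
  have h := Int.le_ediv_iff_mul_le (a := 1) (b := s) he
  have h' := Int.ediv_nonneg h0 he.le
  omega

theorem exists_decomp {n : ℤ} (hn : 0 < n) (t : ℤ) :
    ∃ q s : ℤ, 0 ≤ s ∧ s < n ∧ t = 1 + s + n * q :=
  ⟨(t - 1) / n, (t - 1) % n, Int.emod_nonneg _ hn.ne', Int.emod_lt_of_pos _ hn, by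
    linear_combination -Int.emod_add_mul_ediv (t - 1) n⟩

/-- For integers `e ≥ 2` and `r ≥ 2`, the map `ψ` is a strictly
increasing bijection from `ℤ ∖ 𝟙_r = {t : bFun e r t ≠ 1}` onto `ℤ`. -/
theorem psi_strictMonoOn_bijOn (e r : ℤ) (he : 2 ≤ e) (hr : 2 ≤ r) :
    StrictMonoOn (psi e r) {t : ℤ | bFun e r t ≠ 1} ∧
    Set.BijOn (psi e r) {t : ℤ | bFun e r t ≠ 1} Set.univ := by
  have he0 : 0 < e := by linarith
  have hn : 0 < e * r := mul_pos he0 (by linarith)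
  have hmono : StrictMonoOn (psi e r) {t : ℤ | bFun e r t ≠ 1} := by
    intro x hx y hy hxy
    obtain ⟨q, s, h0, h1, rfl⟩ := exists_decomp hn x
    obtain ⟨q', s', h0', h1', rfl⟩ := exists_decomp hn y
    have hs' := (bFun_ne_one_iff_of_decomp he0 h0' h1').1 hy
    rw [psi_eq_of_decomp h0 h1, psi_eq_of_decomp h0' h1']
    have hq : q ≤ q' := by
      by_contra! hlt
      nlinarith [mul_le_mul_of_nonneg_left (Int.add_one_le_of_lt hlt) hn.le]
    rcases hq.eq_or_lt with rfl | hlt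
    · linarith
    · have hk : 0 ≤ e * (r - 1) := mul_nonneg he0.le (by linarith)
      nlinarith [mul_le_mul_of_nonneg_left (Int.add_one_le_of_lt hlt) hk]
  refine ⟨hmono, Set.mapsTo_univ _ _, hmono.injOn, fun y _ => ?_⟩
  obtain ⟨q, s, h0, h1, rfl⟩ := exists_decomp (mul_pos he0 (by linarith : 0 < r - 1)) y
  have h0' : 0 ≤ s + e := by linarith
  have h1' : s + e < e * r := by linarith
  exact ⟨1 + (s + e) + e * r * q, (bFun_ne_one_iff_of_decomp he0 h0' h1').2 (by linarith),
    by rw [psi_eq_of_decomp h0' h1']; ring⟩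

end
end

section
/- Let e ≥ 2 and r ≥ 2 be integers, define ψ on ℤ∖𝟙_r by ψ(t) = a_r(t) + e(b_r(t)−2) − e(r−1)·m_r(t), and let l, n ≥ 1. Suppose t_{ij} ∈ ℤ∖𝟙_r for 1 ≤ i ≤ n and 1 ≤ j ≤ l, and c_1,…,c_n ∈ ℚ(q). Then Σ_{i=1}^n c_i |t_{i1}⟩∧…∧|t_{il}⟩ = 0 in the l-wedge space Λ^l_{e,r} (defined with parameter r' = r) if and only if Σ_{i=1}^n c_i |ψ(t_{i1})⟩∧…∧|ψ(t_{il})⟩ = 0 in the l-wedge space Λ^l_{e,r−1} (defined with parameter r' = r−1). -/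
noncomputable section

/-- The free `ℚ(q)`-module on the set of `l`-tuples of integers
(the basis element at `(t₁,…,t_l)` is the formal wedge `|t₁⟩∧…∧|t_l⟩`). -/
abbrev FW (l : ℕ) := (Fin l → ℤ) →₀ K

/-- The formal two-entry wedge `|x⟩∧|y⟩` in the free module on pairs. -/
def pairTerm (x y : ℤ) : (ℤ × ℤ) →₀ K := Finsupp.single (x, y) 1

/-- The sum `Σ_{m ≥ m0} coeff m · |u−γ−Nm⟩∧|t+γ+Nm⟩`, where `m` ranges only over those
values for which the displayed wedge is ordered (first entry strictly bigger).  Since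
`N ≥ 2` and `γ ≥ 0` in all uses, all such `m` satisfy `m ≤ (u−t).toNat`, so the
following finite sum captures all of them. -/
def pairSum (N t u γ : ℤ) (m0 : ℕ) (coeff : ℕ → K) : (ℤ × ℤ) →₀ K :=
  ∑ m ∈ Finset.Ico m0 ((u - t).toNat + 1),
    if t + γ + N * m < u - γ - N * m then coeff m • pairTerm (u - γ - N * m) (t + γ + N * m)
    else 0

/-- For `t ≤ u`, the right-hand side of the straightening relation for `|t⟩∧|u⟩`
in the wedge space with parameters `e, r`. -/
def pairRHS (e r t u : ℤ) : (ℤ × ℤ) →₀ K :=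
  let N := e * r
  let α := (aFun e u - aFun e t) % N
  let β := (e * (bFun e r u - bFun e r t)) % N
  if α = 0 ∧ β = 0 then -pairTerm u t
  else if β = 0 then
    -(qK⁻¹ • pairTerm u t) +
      (qK ^ (-2 : ℤ) - 1) •
        (pairSum N t u α 0 (fun m => qK ^ (-2 * (m : ℤ))) -
          pairSum N t u 0 1 (fun m => qK ^ (1 - 2 * (m : ℤ))))
  else if α = 0 then
    -(qK • pairTerm u t) +
      (qK ^ (2 : ℤ) - 1) •
        (pairSum N t u β 0 (fun m => qK ^ (2 * (m : ℤ))) -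
          pairSum N t u 0 1 (fun m => qK ^ (2 * (m : ℤ) - 1)))
  else
    -pairTerm u t +
      (qK - qK⁻¹) • pairSum N t u β 0
        (fun m => (qK ^ (2 * (m : ℤ) + 1) + qK ^ (-2 * (m : ℤ) - 1)) / (qK + qK⁻¹)) +
      (qK⁻¹ - qK) • pairSum N t u α 0
        (fun m => (qK ^ (2 * (m : ℤ) + 1) + qK ^ (-2 * (m : ℤ) - 1)) / (qK + qK⁻¹)) +
      (qK - qK⁻¹) • pairSum N t u (α + β) 0
        (fun m => (qK ^ (2 * (m : ℤ) + 2) - qK ^ (-2 * (m : ℤ) - 2)) / (qK + qK⁻¹)) +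
      (qK⁻¹ - qK) • pairSum N t u 0 1
        (fun m => (qK ^ (2 * (m : ℤ)) - qK ^ (-2 * (m : ℤ))) / (qK + qK⁻¹))

/-- Replace the entries of an `l`-tuple at positions `j` and `j+1` by `p.1` and `p.2`. -/
def updPair (l : ℕ) (ts : Fin l → ℤ) (j : ℕ) (p : ℤ × ℤ) : Fin l → ℤ :=
  fun i => if (i : ℕ) = j then p.1 else if (i : ℕ) = j + 1 then p.2 else ts i

/-- The set of straightening relators: for every `l`-tuple `ts` and every pair of
adjacent positions `j, j+1` with `ts j ≤ ts (j+1)`, the element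
`|ts⟩ − (RHS of the straightening relation applied at positions j, j+1)`. -/
def relSet (e r : ℤ) (l : ℕ) : Set (FW l) :=
  {x | ∃ (ts : Fin l → ℤ) (j j' : Fin l), (j' : ℕ) = (j : ℕ) + 1 ∧ ts j ≤ ts j' ∧
      x = Finsupp.single ts 1 -
        (pairRHS e r (ts j) (ts j')).sum fun p c => Finsupp.single (updPair l ts (j : ℕ) p) c}

/-- The `l`-wedge space `Λ^l_{e,r}`: the quotient of the free module on `l`-tuples by
the straightening relations. -/
abbrev WedgeSpace (e r : ℤ) (l : ℕ) := FW l ⧸ Submodule.span K (relSet e r l)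

/-- The image of the wedge `|ts 0⟩∧…∧|ts (l−1)⟩` in the `l`-wedge space. -/
def wedge (e r : ℤ) (l : ℕ) (ts : Fin l → ℤ) : WedgeSpace e r l :=
  Submodule.Quotient.mk (Finsupp.single ts 1)

/-! ### Coordinates of an integer -/

section Coordinates

variable {e r : ℤ}

theorem aFun_coord {a : ℤ} (b k : ℤ) (ha : 1 ≤ a) (hae : a ≤ e) :
    aFun e (a + e * (b - 1) + e * r * k) = a := by
  have h : a + e * (b - 1) + e * r * k - 1 = (a - 1) + e * (b - 1 + r * k) := by ring
  rw [aFun, h, Int.add_mul_emod_self_left, Int.emod_eq_of_lt (by lia) (by lia)]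
  ring

theorem bFun_coord {a b : ℤ} (k : ℤ) (ha : 1 ≤ a) (hae : a ≤ e) (hb : 1 ≤ b) (hbr : b ≤ r) :
    bFun e r (a + e * (b - 1) + e * r * k) = b := by
  have h : a + e * (b - 1) + e * r * k - 1 = (a - 1 + e * (b - 1)) + e * r * k := by ring
  have h₀ : 0 ≤ e * (b - 1) := mul_nonneg (by lia) (by lia)
  have h₁ : 0 ≤ e * (r - b) := mul_nonneg (by lia) (by lia)
  rw [bFun, h, Int.add_mul_emod_self_left, Int.emod_eq_of_lt (by lia) (by nlinarith),
    Int.add_mul_ediv_left _ _ (by lia), Int.ediv_eq_zero_of_lt (by lia) (by lia)]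
  ring

theorem psi_coord {a b : ℤ} (k : ℤ) (ha : 1 ≤ a) (hae : a ≤ e) (hb : 1 ≤ b) (hbr : b ≤ r) :
    psi e r (a + e * (b - 1) + e * r * k) = a + e * (b - 1 - 1) + e * (r - 1) * k := by
  have hN : e * r ≠ 0 := mul_ne_zero (by lia) (by lia)
  have hm : mFun e r (a + e * (b - 1) + e * r * k) = -k := by
    rw [mFun, aFun_coord b k ha hae, bFun_coord k ha hae hb hbr]
    exact Int.ediv_eq_of_eq_mul_right hN (by ring)
  rw [psi, hm, aFun_coord b k ha hae, bFun_coord k ha hae hb hbr]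
  ring

theorem exists_coord (he : 1 ≤ e) (hr : 1 ≤ r) (t : ℤ) :
    ∃ a b k : ℤ, 1 ≤ a ∧ a ≤ e ∧ 1 ≤ b ∧ b ≤ r ∧ t = a + e * (b - 1) + e * r * k := by
  have h₁ := Int.emod_nonneg (t - 1) (show e ≠ 0 by lia)
  have h₂ := Int.emod_lt_of_pos (t - 1) (show 0 < e by lia)
  have h₃ := Int.emod_nonneg ((t - 1) / e) (show r ≠ 0 by lia)
  have h₄ := Int.emod_lt_of_pos ((t - 1) / e) (show 0 < r by lia)
  refine ⟨(t - 1) % e + 1, (t - 1) / e % r + 1, (t - 1) / e / r,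
    by lia, by lia, by lia, by lia, ?_⟩
  have h₅ := Int.mul_ediv_add_emod (t - 1) e
  have h₆ := Int.mul_ediv_add_emod ((t - 1) / e) r
  linear_combination -h₅ - e * h₆

theorem bFun_add_mul (t m : ℤ) : bFun e r (t + e * r * m) = bFun e r t := by
  rw [bFun, bFun, show t + e * r * m - 1 = t - 1 + e * r * m by ring, Int.add_mul_emod_self_left]

theorem psi_add_mul (he : 1 ≤ e) (hr : 1 ≤ r) (t m : ℤ) :
    psi e r (t + e * r * m) = psi e r t + e * (r - 1) * m := by
  obtain ⟨a, b, k, ha, hae, hb, hbr, rfl⟩ := exists_coord he hr t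
  rw [show a + e * (b - 1) + e * r * k + e * r * m = a + e * (b - 1) + e * r * (k + m) by ring,
    psi_coord _ ha hae hb hbr, psi_coord _ ha hae hb hbr]
  ring

theorem coord_lt_coord {a a' b b' k k' : ℤ} (ha : 1 ≤ a) (hae : a ≤ e) (hb : 1 ≤ b) (hbr : b ≤ r)
    (ha' : 1 ≤ a') (hae' : a' ≤ e) (hb' : 1 ≤ b') (hbr' : b' ≤ r) :
    a + e * (b - 1) + e * r * k < a' + e * (b' - 1) + e * r * k' ↔
      k < k' ∨ k = k' ∧ (b < b' ∨ b = b' ∧ a < a') := by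
  have key : ∀ {a a' b b' k k' : ℤ}, 1 ≤ a → a ≤ e → 1 ≤ b → b ≤ r → 1 ≤ a' → a' ≤ e →
      1 ≤ b' → b' ≤ r → (k < k' ∨ k = k' ∧ (b < b' ∨ b = b' ∧ a < a')) →
      a + e * (b - 1) + e * r * k < a' + e * (b' - 1) + e * r * k' := by
    rintro a a' b b' k k' ha hae hb hbr ha' hae' hb' hbr' (h | ⟨rfl, h | ⟨rfl, h⟩⟩)
    · have h₁ : 0 ≤ e * r * (k' - k - 1) :=
        mul_nonneg (mul_nonneg (by lia) (by lia)) (by lia)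
      have h₂ : 0 ≤ e * (r - b) := mul_nonneg (by lia) (by lia)
      have h₃ : 0 ≤ e * (b' - 1) := mul_nonneg (by lia) (by lia)
      linarith
    · have h₁ : 0 ≤ e * (b' - b - 1) := mul_nonneg (by lia) (by lia)
      linarith
    · linarith
  refine ⟨fun h => ?_, key ha hae hb hbr ha' hae' hb' hbr'⟩
  by_contra hn
  have h' : (k' < k ∨ k' = k ∧ (b' < b ∨ b' = b ∧ a' < a)) ∨ (k = k' ∧ b = b' ∧ a = a') := by
    lia
  rcases h' with h' | ⟨rfl, rfl, rfl⟩
  · exact lt_asymm h (key ha' hae' hb' hbr' ha hae hb hbr h')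
  · exact lt_irrefl _ h

theorem psi_lt_psi_iff (he : 1 ≤ e) (hr : 1 ≤ r) {t u : ℤ} (ht : bFun e r t ≠ 1)
    (hu : bFun e r u ≠ 1) : psi e r t < psi e r u ↔ t < u := by
  obtain ⟨a, b, k, ha, hae, hb, hbr, rfl⟩ := exists_coord he hr t
  obtain ⟨a', b', k', ha', hae', hb', hbr', rfl⟩ := exists_coord he hr u
  rw [bFun_coord _ ha hae hb hbr] at ht
  rw [bFun_coord _ ha' hae' hb' hbr'] at hu
  rw [psi_coord _ ha hae hb hbr, psi_coord _ ha' hae' hb' hbr',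
    coord_lt_coord ha hae hb hbr ha' hae' hb' hbr',
    coord_lt_coord ha hae (by lia) (by lia) ha' hae' (by lia) (by lia)]
  lia

/-- The inverse of `psi e r`, as a map `ℤ → ℤ ∖ 𝟙_r`. -/
def psiInv (e r t : ℤ) : ℤ := t + e * ((t - 1) / (e * (r - 1)) + 1)

theorem psiInv_coord {a b : ℤ} (k : ℤ) (ha : 1 ≤ a) (hae : a ≤ e) (hb : 1 ≤ b)
    (hbr : b ≤ r - 1) : psiInv e r (a + e * (b - 1) + e * (r - 1) * k) =
      a + e * (b + 1 - 1) + e * r * k := by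
  have h : a + e * (b - 1) + e * (r - 1) * k - 1 = (a - 1 + e * (b - 1)) + e * (r - 1) * k := by
    ring
  have h₀ : 0 ≤ e * (b - 1) := mul_nonneg (by lia) (by lia)
  have h₁ : 0 ≤ e * (r - 1 - b) := mul_nonneg (by lia) (by lia)
  rw [psiInv, h, Int.add_mul_ediv_left _ _ (mul_ne_zero (by lia) (by lia)),
    Int.ediv_eq_zero_of_lt (by lia) (by nlinarith)]
  ring

theorem psi_psiInv (he : 1 ≤ e) (hr : 2 ≤ r) (t : ℤ) : psi e r (psiInv e r t) = t := by
  obtain ⟨a, b, k, ha, hae, hb, hbr, rfl⟩ := exists_coord he (show 1 ≤ r - 1 by lia) t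
  rw [psiInv_coord _ ha hae hb hbr, psi_coord _ ha hae (by lia) (by lia)]
  ring

theorem bFun_psiInv_ne_one (he : 1 ≤ e) (hr : 2 ≤ r) (t : ℤ) : bFun e r (psiInv e r t) ≠ 1 := by
  obtain ⟨a, b, k, ha, hae, hb, hbr, rfl⟩ := exists_coord he (show 1 ≤ r - 1 by lia) t
  rw [psiInv_coord _ ha hae hb hbr, bFun_coord _ ha hae (by lia) (by lia)]
  lia

theorem psiInv_psi (he : 1 ≤ e) (hr : 2 ≤ r) {t : ℤ} (ht : bFun e r t ≠ 1) :
    psiInv e r (psi e r t) = t := by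
  obtain ⟨a, b, k, ha, hae, hb, hbr, rfl⟩ := exists_coord he (show 1 ≤ r by lia) t
  rw [bFun_coord _ ha hae hb hbr] at ht
  rw [psi_coord _ ha hae hb hbr, psiInv_coord _ ha hae (by lia) (by lia)]
  ring

end Coordinates

/-! ### The shifts occurring in the straightening relations -/

section Shifts

variable {e r t u : ℤ}

/-- The residue `α` of the straightening relation for `|t⟩∧|u⟩`. -/
def alphaShift (e r t u : ℤ) : ℤ := (aFun e u - aFun e t) % (e * r)

/-- The residue `β` of the straightening relation for `|t⟩∧|u⟩`. -/
def betaShift (e r t u : ℤ) : ℤ := (e * (bFun e r u - bFun e r t)) % (e * r)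

/-- Moving `γ` from `u` to `t` permutes the values of `bFun e r` on the pair `(t, u)`. -/
def PreservesBlocks (e r t u γ : ℤ) : Prop :=
  bFun e r (u - γ) = bFun e r u ∧ bFun e r (t + γ) = bFun e r t ∨
    bFun e r (u - γ) = bFun e r t ∧ bFun e r (t + γ) = bFun e r u

theorem preservesBlocks_zero : PreservesBlocks e r t u 0 := by simp [PreservesBlocks]

theorem emod_eq_ite {x N : ℤ} (h₁ : -N < x) (h₂ : x < N) :
    x % N = x + N * (if x < 0 then 1 else 0) := by
  split_ifs with h
  · rw [← Int.add_emod_right, Int.emod_eq_of_lt (by lia) (by lia), mul_one]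
  · rw [Int.emod_eq_of_lt (by lia) h₂, mul_zero, add_zero]

/-- In coordinates, the residues `α` and `β` amount to exchanging the `a`- respectively
`b`-coordinates of the two entries, with the same carry for all values of `r`. -/
theorem exists_shift_coord (he : 1 ≤ e) (hr : 1 ≤ r) (t u : ℤ) :
    ∃ a b k a' b' k' ε δ : ℤ, (1 ≤ a ∧ a ≤ e ∧ 1 ≤ b ∧ b ≤ r) ∧
      (1 ≤ a' ∧ a' ≤ e ∧ 1 ≤ b' ∧ b' ≤ r) ∧
      t = a + e * (b - 1) + e * r * k ∧ u = a' + e * (b' - 1) + e * r * k' ∧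
      alphaShift e r t u = a' - a + e * r * ε ∧ betaShift e r t u = e * (b' - b) + e * r * δ ∧
      (b ≠ 1 → b' ≠ 1 →
        alphaShift e (r - 1) (psi e r t) (psi e r u) = a' - a + e * (r - 1) * ε ∧
        betaShift e (r - 1) (psi e r t) (psi e r u) = e * (b' - b) + e * (r - 1) * δ) := by
  obtain ⟨a, b, k, ha, hae, hb, hbr, rfl⟩ := exists_coord he hr t
  obtain ⟨a', b', k', ha', hae', hb', hbr', rfl⟩ := exists_coord he hr u
  have hN : e ≤ e * r := by nlinarith
  refine ⟨a, b, k, a', b', k', if a' - a < 0 then 1 else 0, if b' - b < 0 then 1 else 0,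
    ⟨ha, hae, hb, hbr⟩, ⟨ha', hae', hb', hbr'⟩, rfl, rfl, ?_, ?_, fun h h' => ⟨?_, ?_⟩⟩
  · rw [alphaShift, aFun_coord _ _ ha hae, aFun_coord _ _ ha' hae', emod_eq_ite] <;> lia
  · rw [betaShift, bFun_coord _ ha hae hb hbr, bFun_coord _ ha' hae' hb' hbr',
      Int.mul_emod_mul_of_pos _ _ (by lia), emod_eq_ite (by lia) (by lia)]
    ring
  · have hN' : e ≤ e * (r - 1) := by nlinarith [show 2 ≤ r by lia]
    rw [psi_coord _ ha hae hb hbr, psi_coord _ ha' hae' hb' hbr', alphaShift,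
      aFun_coord _ _ ha hae, aFun_coord _ _ ha' hae', emod_eq_ite] <;> lia
  · rw [psi_coord _ ha hae hb hbr, psi_coord _ ha' hae' hb' hbr', betaShift,
      bFun_coord _ ha hae (by lia) (by lia), bFun_coord _ ha' hae' (by lia) (by lia),
      Int.mul_emod_mul_of_pos _ _ (by lia), emod_eq_ite (by lia) (by lia)]
    have h₁ : b' - 1 - (b - 1) = b' - b := by ring
    rw [h₁]
    ring

theorem preservesBlocks_shifts (he : 1 ≤ e) (hr : 1 ≤ r) (t u : ℤ) :
    PreservesBlocks e r t u (alphaShift e r t u) ∧ PreservesBlocks e r t u (betaShift e r t u) ∧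
      PreservesBlocks e r t u (alphaShift e r t u + betaShift e r t u) := by
  obtain ⟨a, b, k, a', b', k', ε, δ, ⟨ha, hae, hb, hbr⟩, ⟨ha', hae', hb', hbr'⟩, rfl, rfl,
    hα, hβ, -⟩ := exists_shift_coord he hr t u
  rw [hα, hβ]
  refine ⟨Or.inl ⟨?_, ?_⟩, Or.inr ⟨?_, ?_⟩, Or.inr ⟨?_, ?_⟩⟩
  · rw [bFun_coord _ ha' hae' hb' hbr']
    exact (congrArg _ (by ring)).trans (bFun_coord (k' - ε) ha hae hb' hbr')
  · rw [bFun_coord _ ha hae hb hbr]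
    exact (congrArg _ (by ring)).trans (bFun_coord (k + ε) ha' hae' hb hbr)
  · rw [bFun_coord _ ha hae hb hbr]
    exact (congrArg _ (by ring)).trans (bFun_coord (k' - δ) ha' hae' hb hbr)
  · rw [bFun_coord _ ha' hae' hb' hbr']
    exact (congrArg _ (by ring)).trans (bFun_coord (k + δ) ha hae hb' hbr')
  · rw [bFun_coord _ ha hae hb hbr]
    exact (congrArg _ (by ring)).trans (bFun_coord (k' - ε - δ) ha hae hb hbr)
  · rw [bFun_coord _ ha' hae' hb' hbr']
    exact (congrArg _ (by ring)).trans (bFun_coord (k + ε + δ) ha' hae' hb' hbr')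

/-- Moving `γ` from `u` to `t` corresponds under `psi e r` to moving `γ'`. -/
def PsiShift (e r t u γ γ' : ℤ) : Prop :=
  psi e r (u - γ) = psi e r u - γ' ∧ psi e r (t + γ) = psi e r t + γ'

theorem psiShift_zero : PsiShift e r t u 0 0 := by simp [PsiShift]

theorem psiShift_shifts (he : 1 ≤ e) (hr : 1 ≤ r) (ht : bFun e r t ≠ 1) (hu : bFun e r u ≠ 1) :
    PsiShift e r t u (alphaShift e r t u) (alphaShift e (r - 1) (psi e r t) (psi e r u)) ∧
    PsiShift e r t u (betaShift e r t u) (betaShift e (r - 1) (psi e r t) (psi e r u)) ∧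
    PsiShift e r t u (alphaShift e r t u + betaShift e r t u)
      (alphaShift e (r - 1) (psi e r t) (psi e r u) +
        betaShift e (r - 1) (psi e r t) (psi e r u)) := by
  obtain ⟨a, b, k, a', b', k', ε, δ, ⟨ha, hae, hb, hbr⟩, ⟨ha', hae', hb', hbr'⟩, rfl, rfl,
    hα, hβ, h⟩ := exists_shift_coord he hr t u
  rw [bFun_coord _ ha hae hb hbr] at ht
  rw [bFun_coord _ ha' hae' hb' hbr'] at hu
  obtain ⟨hα', hβ'⟩ := h ht hu
  rw [hα, hβ, hα', hβ']
  refine ⟨⟨?_, ?_⟩, ⟨?_, ?_⟩, ⟨?_, ?_⟩⟩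
  · rw [psi_coord _ ha' hae' hb' hbr']
    refine (congrArg _ ?_).trans ((psi_coord (k' - ε) ha hae hb' hbr').trans ?_) <;> ring
  · rw [psi_coord _ ha hae hb hbr]
    refine (congrArg _ ?_).trans ((psi_coord (k + ε) ha' hae' hb hbr).trans ?_) <;> ring
  · rw [psi_coord _ ha' hae' hb' hbr']
    refine (congrArg _ ?_).trans ((psi_coord (k' - δ) ha' hae' hb hbr).trans ?_) <;> ring
  · rw [psi_coord _ ha hae hb hbr]
    refine (congrArg _ ?_).trans ((psi_coord (k + δ) ha hae hb' hbr').trans ?_) <;> ring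
  · rw [psi_coord _ ha' hae' hb' hbr']
    refine (congrArg _ ?_).trans ((psi_coord (k' - ε - δ) ha hae hb hbr).trans ?_) <;> ring
  · rw [psi_coord _ ha hae hb hbr]
    refine (congrArg _ ?_).trans ((psi_coord (k + ε + δ) ha' hae' hb' hbr').trans ?_) <;> ring

theorem alphaShift_nonneg (he : 1 ≤ e) (hr : 1 ≤ r) : 0 ≤ alphaShift e r t u :=
  Int.emod_nonneg _ (mul_ne_zero (by lia) (by lia))

theorem betaShift_nonneg (he : 1 ≤ e) (hr : 1 ≤ r) : 0 ≤ betaShift e r t u :=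
  Int.emod_nonneg _ (mul_ne_zero (by lia) (by lia))

theorem alphaShift_eq_zero_iff (he : 1 ≤ e) (hr : 1 ≤ r) :
    alphaShift e r t u = 0 ↔ aFun e u = aFun e t := by
  obtain ⟨a, b, k, ha, hae, hb, hbr, rfl⟩ := exists_coord he hr t
  obtain ⟨a', b', k', ha', hae', hb', hbr', rfl⟩ := exists_coord he hr u
  have hN : e ≤ e * r := by nlinarith
  rw [alphaShift, aFun_coord _ _ ha hae, aFun_coord _ _ ha' hae', emod_eq_ite (by lia) (by lia)]
  split_ifs <;> lia

theorem betaShift_eq_zero_iff (he : 1 ≤ e) (hr : 1 ≤ r) :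
    betaShift e r t u = 0 ↔ bFun e r u = bFun e r t := by
  obtain ⟨a, b, k, ha, hae, hb, hbr, rfl⟩ := exists_coord he hr t
  obtain ⟨a', b', k', ha', hae', hb', hbr', rfl⟩ := exists_coord he hr u
  rw [betaShift, bFun_coord _ ha hae hb hbr, bFun_coord _ ha' hae' hb' hbr',
    Int.mul_emod_mul_of_pos _ _ (by lia), emod_eq_ite (by lia) (by lia), mul_eq_zero]
  split_ifs <;> lia

theorem aFun_psi (he : 1 ≤ e) (hr : 1 ≤ r) (t : ℤ) : aFun e (psi e r t) = aFun e t := by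
  obtain ⟨a, b, k, ha, hae, hb, hbr, rfl⟩ := exists_coord he hr t
  rw [psi_coord _ ha hae hb hbr, aFun_coord _ _ ha hae, aFun_coord _ _ ha hae]

theorem bFun_psi (he : 1 ≤ e) (hr : 1 ≤ r) (ht : bFun e r t ≠ 1) :
    bFun e (r - 1) (psi e r t) = bFun e r t - 1 := by
  obtain ⟨a, b, k, ha, hae, hb, hbr, rfl⟩ := exists_coord he hr t
  rw [bFun_coord _ ha hae hb hbr] at ht
  rw [psi_coord _ ha hae hb hbr, bFun_coord _ ha hae (by lia) (by lia),
    bFun_coord _ ha hae hb hbr]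

end Shifts

/-! ### Compatibility of the straightening relations with `psi` -/

section Straightening

variable {e r t u : ℤ}

/-- The summation range of `pairSum` may be enlarged. -/
theorem pairSum_eq_sum {N t u γ : ℤ} (hN : 1 ≤ N) (hγ : 0 ≤ γ) (m0 : ℕ) (coeff : ℕ → K) {M : ℕ}
    (hM : (u - t).toNat + 1 ≤ M) :
    pairSum N t u γ m0 coeff = ∑ m ∈ Finset.Ico m0 M,
      if t + γ + N * m < u - γ - N * m
      then coeff m • pairTerm (u - γ - N * m) (t + γ + N * m) else 0 := by
  refine Finset.sum_subset (Finset.Ico_subset_Ico_right hM) fun m hm hm' => if_neg ?_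
  have h : (m : ℤ) ≤ N * m := le_mul_of_one_le_left (by positivity) hN
  simp only [Finset.mem_Ico] at hm hm'
  lia

theorem lmapDomain_pairSum (he : 1 ≤ e) (hr : 2 ≤ r) (ht : bFun e r t ≠ 1)
    (hu : bFun e r u ≠ 1) {γ γ' : ℤ} (hγ : 0 ≤ γ) (hγ' : 0 ≤ γ') (hb : PreservesBlocks e r t u γ)
    (hs : PsiShift e r t u γ γ') (m0 : ℕ) (coeff : ℕ → K) :
    Finsupp.lmapDomain K K (Prod.map (psi e r) (psi e r)) (pairSum (e * r) t u γ m0 coeff) =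
      pairSum (e * (r - 1)) (psi e r t) (psi e r u) γ' m0 coeff := by
  rw [pairSum_eq_sum (by nlinarith) hγ m0 coeff (le_max_left _ ((psi e r u - psi e r t).toNat + 1)),
    pairSum_eq_sum (by nlinarith) hγ' m0 coeff (le_max_right ((u - t).toNat + 1) _), map_sum]
  refine Finset.sum_congr rfl fun m _ => ?_
  have hx : u - γ - e * r * m = (u - γ) + e * r * (-m) := by ring
  have hb₁ : bFun e r (u - γ - e * r * m) ≠ 1 := by
    rw [hx, bFun_add_mul]
    rcases hb with hb | hb <;> rw [hb.1] <;> assumption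
  have hb₂ : bFun e r (t + γ + e * r * m) ≠ 1 := by
    rw [bFun_add_mul]
    rcases hb with hb | hb <;> rw [hb.2] <;> assumption
  have h₁ : psi e r (u - γ - e * r * m) = psi e r u - γ' - e * (r - 1) * m := by
    rw [hx, psi_add_mul he (by lia), hs.1]
    ring
  have h₂ : psi e r (t + γ + e * r * m) = psi e r t + γ' + e * (r - 1) * m := by
    rw [psi_add_mul he (by lia), hs.2]
  rw [← h₁, ← h₂, apply_ite (Finsupp.lmapDomain K K (Prod.map (psi e r) (psi e r)))]
  simp only [psi_lt_psi_iff he (by lia) hb₂ hb₁, map_smul, map_zero, pairTerm,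
    Finsupp.lmapDomain_apply, Finsupp.mapDomain_single, Prod.map_apply]

theorem lmapDomain_pairRHS (he : 1 ≤ e) (hr : 2 ≤ r) (ht : bFun e r t ≠ 1)
    (hu : bFun e r u ≠ 1) :
    Finsupp.lmapDomain K K (Prod.map (psi e r) (psi e r)) (pairRHS e r t u) =
      pairRHS e (r - 1) (psi e r t) (psi e r u) := by
  have hr₁ : 1 ≤ r := by lia
  have hr₂ : 1 ≤ r - 1 := by lia
  have hα : alphaShift e (r - 1) (psi e r t) (psi e r u) = 0 ↔ alphaShift e r t u = 0 := by
    rw [alphaShift_eq_zero_iff he hr₁, alphaShift_eq_zero_iff he hr₂, aFun_psi he hr₁,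
      aFun_psi he hr₁]
  have hβ : betaShift e (r - 1) (psi e r t) (psi e r u) = 0 ↔ betaShift e r t u = 0 := by
    rw [betaShift_eq_zero_iff he hr₁, betaShift_eq_zero_iff he hr₂, bFun_psi he hr₁ ht,
      bFun_psi he hr₁ hu]
    lia
  have hterm : Finsupp.lmapDomain K K (Prod.map (psi e r) (psi e r)) (pairTerm u t) =
      pairTerm (psi e r u) (psi e r t) := by
    simp [pairTerm]
  obtain ⟨hbα, hbβ, hbαβ⟩ := preservesBlocks_shifts he hr₁ t u
  obtain ⟨hsα, hsβ, hsαβ⟩ := psiShift_shifts he hr₁ ht hu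
  have h₀ := lmapDomain_pairSum he hr ht hu le_rfl le_rfl preservesBlocks_zero psiShift_zero
  have h₁ := lmapDomain_pairSum he hr ht hu (alphaShift_nonneg he hr₁)
    (alphaShift_nonneg he hr₂) hbα hsα
  have h₂ := lmapDomain_pairSum he hr ht hu (betaShift_nonneg he hr₁)
    (betaShift_nonneg he hr₂) hbβ hsβ
  have h₃ := lmapDomain_pairSum he hr ht hu
    (add_nonneg (alphaShift_nonneg he hr₁) (betaShift_nonneg he hr₁))
    (add_nonneg (alphaShift_nonneg he hr₂) (betaShift_nonneg he hr₂)) hbαβ hsαβ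
  simp only [alphaShift, betaShift] at hα hβ h₁ h₂ h₃
  simp only [pairRHS, hα, hβ]
  split_ifs <;> simp only [map_add, map_sub, map_neg, map_smul, hterm, h₀, h₁, h₂, h₃]

/-- The pairs whose entries have the same values of `bFun e r` as `t` and `u`, in some order. -/
def blockPairs (e r t u : ℤ) : Set (ℤ × ℤ) :=
  {p | bFun e r p.1 = bFun e r u ∧ bFun e r p.2 = bFun e r t ∨
    bFun e r p.1 = bFun e r t ∧ bFun e r p.2 = bFun e r u}

theorem pairSum_mem_supported {γ : ℤ} (hb : PreservesBlocks e r t u γ) (m0 : ℕ)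
    (coeff : ℕ → K) :
    pairSum (e * r) t u γ m0 coeff ∈ Finsupp.supported K K (blockPairs e r t u) := by
  refine Submodule.sum_mem _ fun m _ => ?_
  split_ifs
  · refine Submodule.smul_mem _ _ (Finsupp.single_mem_supported K 1 ?_)
    have hx : u - γ - e * r * m = (u - γ) + e * r * (-m) := by ring
    change bFun e r _ = _ ∧ bFun e r _ = _ ∨ bFun e r _ = _ ∧ bFun e r _ = _
    rw [hx, bFun_add_mul, bFun_add_mul]
    exact hb
  · exact Submodule.zero_mem _

theorem pairRHS_mem_supported (he : 1 ≤ e) (hr : 1 ≤ r) (t u : ℤ) :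
    pairRHS e r t u ∈ Finsupp.supported K K (blockPairs e r t u) := by
  obtain ⟨hbα, hbβ, hbαβ⟩ := preservesBlocks_shifts he hr t u
  have hterm : pairTerm u t ∈ Finsupp.supported K K (blockPairs e r t u) :=
    Finsupp.single_mem_supported K 1 (Or.inl ⟨rfl, rfl⟩)
  have h₀ := pairSum_mem_supported (e := e) (r := r) (t := t) (u := u) preservesBlocks_zero
  have h₁ := pairSum_mem_supported hbα
  have h₂ := pairSum_mem_supported hbβ
  have h₃ := pairSum_mem_supported hbαβ
  simp only [alphaShift, betaShift] at h₁ h₂ h₃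
  simp only [pairRHS]
  split_ifs
  · exact neg_mem hterm
  · exact add_mem (neg_mem (Submodule.smul_mem _ _ hterm))
      (Submodule.smul_mem _ _ (sub_mem (h₁ _ _) (h₀ _ _)))
  · exact add_mem (neg_mem (Submodule.smul_mem _ _ hterm))
      (Submodule.smul_mem _ _ (sub_mem (h₂ _ _) (h₀ _ _)))
  · exact add_mem (add_mem (add_mem (add_mem (neg_mem hterm)
      (Submodule.smul_mem _ _ (h₂ _ _))) (Submodule.smul_mem _ _ (h₁ _ _)))
      (Submodule.smul_mem _ _ (h₃ _ _))) (Submodule.smul_mem _ _ (h₀ _ _))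

end Straightening

/-! ### The induced maps between free modules -/

section FreeModules

variable {e r : ℤ} {l : ℕ}

theorem comp_updPair (f : ℤ → ℤ) (ts : Fin l → ℤ) (j : ℕ) (p : ℤ × ℤ) :
    f ∘ updPair l ts j p = updPair l (f ∘ ts) j (Prod.map f f p) := by
  ext i
  simp only [updPair, Function.comp_apply, Prod.map_fst, Prod.map_snd]
  split_ifs <;> rfl

theorem forall_updPair_iff {ts : Fin l → ℤ} {j j' : Fin l} (hj : (j' : ℕ) = (j : ℕ) + 1)
    {p : ℤ × ℤ} (hp : p ∈ blockPairs e r (ts j) (ts j')) :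
    (∀ i, bFun e r (updPair l ts j p i) ≠ 1) ↔ ∀ i, bFun e r (ts i) ≠ 1 := by
  have hj₁ : updPair l ts j p j = p.1 := by simp [updPair]
  have hj₂ : updPair l ts j p j' = p.2 := by simp [updPair, hj]
  have hne : ∀ i, i ≠ j → i ≠ j' → updPair l ts j p i = ts i := fun i h h' => by
    rw [updPair, if_neg (by lia), if_neg (by lia)]
  constructor
  · intro h i
    have h₁ := h j
    have h₂ := h j'
    rw [hj₁] at h₁
    rw [hj₂] at h₂
    by_cases hi : i = j
    · subst hi
      rcases hp with hp | hp
      · exact hp.2 ▸ h₂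
      · exact hp.1 ▸ h₁
    · by_cases hi' : i = j'
      · subst hi'
        rcases hp with hp | hp
        · exact hp.1 ▸ h₁
        · exact hp.2 ▸ h₂
      · exact hne i hi hi' ▸ h i
  · intro h i
    by_cases hi : i = j
    · subst hi
      rw [hj₁]
      rcases hp with hp | hp <;> rw [hp.1] <;> exact h _
    · by_cases hi' : i = j'
      · subst hi'
        rw [hj₂]
        rcases hp with hp | hp <;> rw [hp.2] <;> exact h _
      · rw [hne i hi hi']
        exact h i

open Classical in
/-- The linear map applying `psi e r` to every entry of a formal wedge, and killing the formal
wedges having an entry in `𝟙_r`. -/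
def psiMap (e r : ℤ) (l : ℕ) : FW l →ₗ[K] FW l :=
  Finsupp.linearCombination K fun ts =>
    if ∀ i, bFun e r (ts i) ≠ 1 then Finsupp.single (psi e r ∘ ts) 1 else 0

theorem psiMap_single {ts : Fin l → ℤ} (h : ∀ i, bFun e r (ts i) ≠ 1) (c : K) :
    psiMap e r l (Finsupp.single ts c) = Finsupp.single (psi e r ∘ ts) c := by
  rw [psiMap, Finsupp.linearCombination_single, if_pos h, Finsupp.smul_single_one]

theorem psiMap_single_eq_zero {ts : Fin l → ℤ} (h : ¬ ∀ i, bFun e r (ts i) ≠ 1) (c : K) :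
    psiMap e r l (Finsupp.single ts c) = 0 := by
  rw [psiMap, Finsupp.linearCombination_single, if_neg h, smul_zero]

theorem psiMap_mem_span (he : 1 ≤ e) (hr : 2 ≤ r) {x : FW l}
    (hx : x ∈ Submodule.span K (relSet e r l)) :
    psiMap e r l x ∈ Submodule.span K (relSet e (r - 1) l) := by
  suffices h : Submodule.span K (relSet e r l) ≤
      (Submodule.span K (relSet e (r - 1) l)).comap (psiMap e r l) from h hx
  refine Submodule.span_le.2 ?_
  rintro _ ⟨ts, j, j', hj, hle, rfl⟩
  have hsupp := (Finsupp.mem_supported K _).1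
    (pairRHS_mem_supported he (show 1 ≤ r by lia) (ts j) (ts j'))
  rw [SetLike.mem_coe, Submodule.mem_comap, map_sub, map_finsuppSum]
  by_cases h : ∀ i, bFun e r (ts i) ≠ 1
  · refine Submodule.subset_span ⟨psi e r ∘ ts, j, j', hj, ?_, ?_⟩
    · exact not_lt.1 fun hlt =>
        not_lt.2 hle ((psi_lt_psi_iff he (by lia) (h _) (h _)).1 hlt)
    · rw [psiMap_single h, Function.comp_apply, Function.comp_apply,
        ← lmapDomain_pairRHS he hr (h j) (h j'), Finsupp.lmapDomain_apply,
        Finsupp.sum_mapDomain_index (fun _ => Finsupp.single_zero _)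
          (fun _ _ _ => Finsupp.single_add _ _ _)]
      congr 1
      refine Finsupp.sum_congr fun p hp => ?_
      rw [psiMap_single ((forall_updPair_iff hj (hsupp hp)).2 h), comp_updPair]
  · rw [psiMap_single_eq_zero h, Finsupp.sum, Finset.sum_eq_zero, sub_zero]
    · exact Submodule.zero_mem _
    · exact fun p hp => psiMap_single_eq_zero (mt (forall_updPair_iff hj (hsupp hp)).1 h) _

theorem mapDomain_psiInv_mem_span (he : 1 ≤ e) (hr : 2 ≤ r) {x : FW l}
    (hx : x ∈ Submodule.span K (relSet e (r - 1) l)) :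
    Finsupp.lmapDomain K K (psiInv e r ∘ ·) x ∈ Submodule.span K (relSet e r l) := by
  suffices h : Submodule.span K (relSet e (r - 1) l) ≤
      (Submodule.span K (relSet e r l)).comap (Finsupp.lmapDomain K K (psiInv e r ∘ ·)) from h hx
  refine Submodule.span_le.2 ?_
  rintro _ ⟨ts, j, j', hj, hle, rfl⟩
  have hb := bFun_psiInv_ne_one he hr
  have hsupp := (Finsupp.mem_supported K _).1
    (pairRHS_mem_supported he (show 1 ≤ r by lia) (psiInv e r (ts j)) (psiInv e r (ts j')))
  refine Submodule.subset_span ⟨psiInv e r ∘ ts, j, j', hj, ?_, ?_⟩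
  · refine not_lt.1 fun hlt => not_lt.2 hle ?_
    rw [← psi_psiInv he hr (ts j), ← psi_psiInv he hr (ts j')]
    exact (psi_lt_psi_iff he (by lia) (hb _) (hb _)).2 hlt
  · have hR := lmapDomain_pairRHS he hr (hb (ts j)) (hb (ts j'))
    rw [psi_psiInv he hr, psi_psiInv he hr, Finsupp.lmapDomain_apply] at hR
    rw [map_sub, map_finsuppSum, ← hR,
      Finsupp.sum_mapDomain_index
        (fun _ => by rw [Finsupp.single_zero, map_zero])
        (fun _ _ _ => by rw [Finsupp.single_add, map_add])]
    simp only [Finsupp.lmapDomain_apply, Finsupp.mapDomain_single, Function.comp_apply]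
    congr 1
    refine Finsupp.sum_congr fun p hp => ?_
    have hp' : Prod.map (psiInv e r) (psiInv e r) (Prod.map (psi e r) (psi e r) p) = p := by
      rcases hsupp hp with hp | hp <;>
        exact Prod.ext (psiInv_psi he hr (by rw [hp.1]; exact hb _))
          (psiInv_psi he hr (by rw [hp.2]; exact hb _))
    rw [comp_updPair, hp']

theorem sum_smul_wedge_eq_zero_iff {n : ℕ} (t : Fin n → Fin l → ℤ) (c : Fin n → K) :
    ∑ i, c i • wedge e r l (t i) = 0 ↔
      ∑ i, Finsupp.single (t i) (c i) ∈ Submodule.span K (relSet e r l) := by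
  rw [← Submodule.Quotient.mk_eq_zero, ← Submodule.mkQ_apply, map_sum]
  refine Eq.congr_left (Finset.sum_congr rfl fun i _ => ?_)
  rw [wedge, ← Submodule.Quotient.mk_smul, Finsupp.smul_single_one, Submodule.mkQ_apply]

end FreeModules

/-- For `e ≥ 2`, `r ≥ 2`, `l, n ≥ 1`, scalars `c i ∈ ℚ(q)` and integers
`t i j ∉ 𝟙_r`, the linear combination `Σᵢ cᵢ |t_{i1}⟩∧…∧|t_{il}⟩` vanishes in `Λ^l_{e,r}`
iff `Σᵢ cᵢ |ψ(t_{i1})⟩∧…∧|ψ(t_{il})⟩` vanishes in `Λ^l_{e,r−1}`. -/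
theorem wedge_comb_eq_zero_iff_psi (e r : ℤ) (he : 2 ≤ e) (hr : 2 ≤ r)
    (l n : ℕ) (hl : 1 ≤ l) (hn : 1 ≤ n)
    (t : Fin n → Fin l → ℤ) (ht : ∀ i j, bFun e r (t i j) ≠ 1) (c : Fin n → K) :
    (∑ i, c i • wedge e r l (t i)) = 0 ↔
      (∑ i, c i • wedge e (r - 1) l fun j => psi e r (t i j)) = 0 := by
  rw [sum_smul_wedge_eq_zero_iff, sum_smul_wedge_eq_zero_iff]
  constructor
  · intro h
    have h' := psiMap_mem_span (by lia) hr h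
    simp only [map_sum, psiMap_single (ht _)] at h'
    exact h'
  · intro h
    have h' := mapDomain_psiInv_mem_span (by lia) hr h
    have hinv : ∀ i, (psiInv e r ∘ fun j => psi e r (t i j)) = t i := fun i =>
      funext fun j => psiInv_psi (by lia) hr (ht i j)
    simpa only [map_sum, Finsupp.lmapDomain_apply, Finsupp.mapDomain_single, hinv] using h'

end
end

section
/- Let e ≥ 2 and r ≥ 2 be integers, and define ψ on ℤ∖𝟙_r by ψ(t) = a_r(t) + e(b_r(t)−2) − e(r−1)·m_r(t). Let μ be an r-multipartition and s̃ ∈ ℤ^r, and set tr μ = (μ^{(2)},…,μ^{(r)}) and tr s̃ = (s̃_2,…,s̃_r). Then ψ maps B_r(μ, s̃) ∖ 𝟙_r bijectively onto B_{r−1}(tr μ, tr s̃); in particular, if u_1 > u_2 > … enumerates B_r(μ, s̃) ∖ 𝟙_r in strictly decreasing order, then ψ(u_1) > ψ(u_2) > … enumerates B_{r−1}(tr μ, tr s̃) in strictly decreasing order. -/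
noncomputable section

/-- A partition: a weakly decreasing sequence of naturals that is eventually zero.
`part i` denotes `λ_{i+1}` (i.e. indexing is 0-based). -/
structure PartitionSeq where
  part : ℕ → ℕ
  antitone' : ∀ i j : ℕ, i ≤ j → part j ≤ part i
  finite' : ∃ N : ℕ, ∀ i : ℕ, N ≤ i → part i = 0

/-- `β̌^{(k)}_i` (with `k` and `i` 0-based): writing
`β = λ^{(k+1)}_{i+1} + s̃_{k+1} + 1 − (i+1)` as `a − e·m` with `a ∈ {1,…,e}`,
this is `a + e·k − e·r·m`. -/
def checkBeta (e : ℤ) (r : ℕ) (lam : Fin r → PartitionSeq) (s : Fin r → ℤ)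
    (k : Fin r) (i : ℕ) : ℤ :=
  let β : ℤ := ((lam k).part i : ℤ) + s k - i
  aFun e β + e * (k : ℕ) - e * r * ((aFun e β - β) / e)

/-- The set `B_r(λ, s̃)` of all `β̌^{(k)}_i`. -/
def Bset (e : ℤ) (r : ℕ) (lam : Fin r → PartitionSeq) (s : Fin r → ℤ) : Set ℤ :=
  Set.range fun p : Fin r × ℕ => checkBeta e r lam s p.1 p.2

theorem aFun_canonical {e r x k m : ℤ} (hx : 1 ≤ x) (hxe : x ≤ e) :
    aFun e (x + e * k - e * r * m) = x := by
  have h : x + e * k - e * r * m - 1 = (x - 1) + e * (k - r * m) := by ring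
  rw [aFun, h, Int.add_mul_emod_self_left, Int.emod_eq_of_lt (by omega) (by omega)]
  ring

theorem bFun_canonical {e r x k m : ℤ} (hx : 1 ≤ x) (hxe : x ≤ e) (hk : 0 ≤ k) (hkr : k < r) :
    bFun e r (x + e * k - e * r * m) = k + 1 := by
  have h : x + e * k - e * r * m - 1 = ((x - 1) + e * k) + e * r * (-m) := by ring
  rw [bFun, h, Int.add_mul_emod_self_left, Int.emod_eq_of_lt (by nlinarith) (by nlinarith),
    Int.add_mul_ediv_left _ _ (by omega), Int.ediv_eq_zero_of_lt (by omega) (by omega), zero_add]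

theorem mFun_canonical {e r x k m : ℤ} (hx : 1 ≤ x) (hxe : x ≤ e) (hk : 0 ≤ k) (hkr : k < r) :
    mFun e r (x + e * k - e * r * m) = m := by
  rw [mFun, aFun_canonical hx hxe, bFun_canonical hx hxe hk hkr]
  refine Int.ediv_eq_of_eq_mul_right (mul_ne_zero (by omega) (by omega)) ?_
  ring

theorem psi_canonical {e r x k m : ℤ} (hx : 1 ≤ x) (hxe : x ≤ e) (hk : 0 ≤ k) (hkr : k < r) :
    psi e r (x + e * k - e * r * m) = x + e * (k - 1) - e * (r - 1) * m := by
  rw [psi, aFun_canonical hx hxe, bFun_canonical hx hxe hk hkr, mFun_canonical hx hxe hk hkr]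
  ring

theorem aFun_mem_Icc {e : ℤ} (he : 0 < e) (t : ℤ) : 1 ≤ aFun e t ∧ aFun e t ≤ e := by
  have h₀ := Int.emod_nonneg (t - 1) he.ne'
  have h₁ := Int.emod_lt_of_pos (t - 1) he
  unfold aFun
  omega

theorem exists_canonical {e r : ℤ} (he : 0 < e) (hr : 0 < r) (t : ℤ) :
    ∃ x k m : ℤ, 1 ≤ x ∧ x ≤ e ∧ 0 ≤ k ∧ k < r ∧ t = x + e * k - e * r * m := by
  refine ⟨aFun e t, (t - 1) / e % r, -((t - 1) / e / r), (aFun_mem_Icc he t).1,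
    (aFun_mem_Icc he t).2, Int.emod_nonneg _ hr.ne', Int.emod_lt_of_pos _ hr, ?_⟩
  have h₁ := Int.emod_add_mul_ediv (t - 1) e
  have h₂ := Int.emod_add_mul_ediv ((t - 1) / e) r
  unfold aFun
  linear_combination -h₁ - e * h₂

/-- The order on canonical forms is lexicographic in `(-m, k, x)`. -/
theorem canonical_lt {e r x k m x' k' m' : ℤ} (hx : 1 ≤ x) (hxe : x ≤ e)
    (hx' : 1 ≤ x') (hxe' : x' ≤ e) (hk : 0 ≤ k) (hkr : k < r) (hk' : 0 ≤ k') (hkr' : k' < r) :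
    x + e * k - e * r * m < x' + e * k' - e * r * m' ↔
      m' < m ∨ m' = m ∧ (k < k' ∨ k = k' ∧ x < x') := by
  have lex : ∀ {x k m x' k' m' : ℤ}, 1 ≤ x → x ≤ e → 1 ≤ x' → x' ≤ e → 0 ≤ k → k < r →
      0 ≤ k' → k' < r → (m' < m ∨ m' = m ∧ (k < k' ∨ k = k' ∧ x < x')) →
      x + e * k - e * r * m < x' + e * k' - e * r * m' := by
    intro x k m x' k' m' hx hxe hx' hxe' hk hkr hk' hkr' h
    have he : 0 < e := by omega
    have hq : ∀ {q q' : ℤ}, q < q' → x + e * q < x' + e * q' := fun {q q'} hq => by nlinarith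
    have h₁ : x + e * k - e * r * m = x + e * (k - r * m) := by ring
    have h₂ : x' + e * k' - e * r * m' = x' + e * (k' - r * m') := by ring
    rw [h₁, h₂]
    rcases h with h | ⟨rfl, h | ⟨rfl, h⟩⟩
    · exact hq (by nlinarith)
    · exact hq (by linarith)
    · linarith
  refine ⟨fun h => ?_, lex hx hxe hx' hxe' hk hkr hk' hkr'⟩
  by_contra hn
  by_cases heq : m = m' ∧ k = k' ∧ x = x'
  · obtain ⟨rfl, rfl, rfl⟩ := heq
    exact h.false
  · exact h.asymm (lex hx' hxe' hx hxe hk' hkr' hk hkr (by omega))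

theorem psi_strictMonoOn {e r : ℤ} (he : 0 < e) (hr : 0 < r) :
    StrictMonoOn (psi e r) {t : ℤ | bFun e r t ≠ 1} := by
  intro t ht t' ht' h
  obtain ⟨x, k, m, hx, hxe, hk, hkr, rfl⟩ := exists_canonical he hr t
  obtain ⟨x', k', m', hx', hxe', hk', hkr', rfl⟩ := exists_canonical he hr t'
  rw [Set.mem_ofPred_eq, bFun_canonical hx hxe hk hkr] at ht
  rw [Set.mem_ofPred_eq, bFun_canonical hx' hxe' hk' hkr'] at ht'
  rw [canonical_lt hx hxe hx' hxe' hk hkr hk' hkr'] at h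
  rw [psi_canonical hx hxe hk hkr, psi_canonical hx' hxe' hk' hkr',
    canonical_lt hx hxe hx' hxe' (by omega) (by omega) (by omega) (by omega)]
  omega

theorem bFun_checkBeta {e : ℤ} (he : 0 < e) {r : ℕ} (lam : Fin r → PartitionSeq)
    (s : Fin r → ℤ) (k : Fin r) (i : ℕ) :
    bFun e r (checkBeta e r lam s k i) = (k : ℕ) + 1 :=
  bFun_canonical (aFun_mem_Icc he _).1 (aFun_mem_Icc he _).2 (by omega) (by omega)

theorem psi_checkBeta {e : ℤ} (he : 0 < e) {r : ℕ} (lam : Fin r → PartitionSeq)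
    (s : Fin r → ℤ) (lam' : Fin (r - 1) → PartitionSeq) (s' : Fin (r - 1) → ℤ)
    (k : Fin r) (k' : Fin (r - 1)) (hk : (k : ℕ) = k' + 1) (hlam : lam' k' = lam k)
    (hs : s' k' = s k) (i : ℕ) :
    psi e r (checkBeta e r lam s k i) = checkBeta e (r - 1) lam' s' k' i := by
  refine (psi_canonical (aFun_mem_Icc he _).1 (aFun_mem_Icc he _).2 (by omega)
    (by omega)).trans ?_
  simp only [checkBeta, hlam, hs, hk]
  rw [Nat.cast_sub (by omega : 1 ≤ r)]
  push_cast
  ring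

/-- For `e ≥ 2`, `r ≥ 2`, an `r`-multipartition `μ` and a multicharge
`s̃ ∈ ℤ^r`, the map `ψ` maps `B_r(μ, s̃) ∖ 𝟙_r` bijectively onto
`B_{r−1}(tr μ, tr s̃)`; in particular (being strictly increasing on this set) it sends the
strictly decreasing enumeration of the former to that of the latter. -/
theorem psi_bijOn_Bset (e : ℤ) (he : 2 ≤ e) (r : ℕ) (hr : 2 ≤ r)
    (μ : Fin r → PartitionSeq) (s : Fin r → ℤ) :
    Set.BijOn (psi e (r : ℤ)) (Bset e r μ s \ {t : ℤ | bFun e (r : ℤ) t = 1})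
        (Bset e (r - 1) (fun k => μ ⟨(k : ℕ) + 1, by have := k.2; omega⟩)
          (fun k => s ⟨(k : ℕ) + 1, by have := k.2; omega⟩)) ∧
      StrictMonoOn (psi e (r : ℤ)) (Bset e r μ s \ {t : ℤ | bFun e (r : ℤ) t = 1}) := by
  have he₀ : 0 < e := by omega
  have hmono : StrictMonoOn (psi e (r : ℤ)) (Bset e r μ s \ {t : ℤ | bFun e (r : ℤ) t = 1}) :=
    (psi_strictMonoOn he₀ (by omega)).mono fun t ht => ht.2
  refine ⟨⟨?_, hmono.injOn, ?_⟩, hmono⟩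
  · rintro _ ⟨⟨⟨k, i⟩, rfl⟩, hb⟩
    rw [Set.mem_ofPred_eq, bFun_checkBeta he₀] at hb
    have hk : (k : ℕ) = ((k : ℕ) - 1) + 1 := by
      dsimp only at hb
      omega
    refine ⟨(⟨(k : ℕ) - 1, by omega⟩, i), ?_⟩
    exact (psi_checkBeta he₀ _ _ _ _ k _ hk (congrArg μ (Fin.ext hk.symm))
      (congrArg s (Fin.ext hk.symm)) i).symm
  · rintro _ ⟨⟨k, i⟩, rfl⟩
    refine ⟨checkBeta e r μ s ⟨(k : ℕ) + 1, by omega⟩ i, ⟨⟨(_, i), rfl⟩, ?_⟩,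
      psi_checkBeta he₀ _ _ _ _ _ k rfl rfl rfl i⟩
    rw [Set.mem_ofPred_eq, bFun_checkBeta he₀]
    push_cast
    omega

end
end

section
/- Let e ≥ 2 and r ≥ 2 be integers and let μ be an r-multipartition with μ^{(1)} = ∅ (the empty partition). Then there exists N ∈ ℕ (depending on e, r and μ) such that for every multicharge s̃ ∈ ℤ^r with s̃_1 − s̃_k ≥ N for all k ∈ {2,…,r}, there is an integer d with d ≥ max B_r(μ, s̃) and B_r(μ, s̃) ∩ 𝟙_r = {t ∈ 𝟙_r : t ≤ d}. -/
noncomputable section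

theorem checkBeta_eq {e : ℤ} (he : 0 < e) (r : ℕ) (lam : Fin r → PartitionSeq)
    (s : Fin r → ℤ) (k : Fin r) (i : ℕ) :
    checkBeta e r lam s k i = ((lam k).part i + s k - i) + e * (k : ℕ) +
      e * (r - 1) * (((lam k).part i + s k - i - 1) / e) := by
  unfold checkBeta aFun
  generalize ((lam k).part i : ℤ) + s k - i = β
  have h := Int.emod_add_mul_ediv (β - 1) e
  have h' : ((β - 1) % e + 1 - β) / e = -((β - 1) / e) := by
    rw [show (β - 1) % e + 1 - β = e * -((β - 1) / e) by linear_combination h]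
    exact Int.mul_ediv_cancel_left _ he.ne'
  dsimp only
  rw [h']
  linear_combination h

theorem strictMono_add_mul_ediv {e c : ℤ} (he : 0 < e) (hc : 0 ≤ c) :
    StrictMono fun x : ℤ => x + c * ((x - 1) / e) := by
  intro x y hxy
  have h : (x - 1) / e ≤ (y - 1) / e := Int.ediv_le_ediv he (by omega)
  have := mul_le_mul_of_nonneg_left h hc
  dsimp only
  omega

theorem exists_add_mul_ediv_eq {e r t : ℤ} (he : 0 < e) (hr : 0 < r) (ht : bFun e r t = 1) :
    ∃ β : ℤ, β + e * (r - 1) * ((β - 1) / e) = t := by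
  have h0 : (t - 1) % (e * r) / e = 0 := by
    unfold bFun at ht
    omega
  have hnn := Int.emod_nonneg (t - 1) (mul_pos he hr).ne'
  have h := Int.emod_add_mul_ediv (t - 1) (e * r)
  refine ⟨(t - 1) % (e * r) + e * ((t - 1) / (e * r)) + 1, ?_⟩
  rw [add_sub_cancel_right, Int.add_mul_ediv_left _ _ he.ne', h0]
  linear_combination h

/-- Let `e ≥ 2`, `r ≥ 2` and let `μ` be an `r`-multipartition with
`μ^{(1)} = ∅`.  Then there is `N ∈ ℕ` such that for every multicharge `s̃` with
`s̃_1 − s̃_k ≥ N` for all `k ∈ {2,…,r}`, there is an integer `d` which is an upper bound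
for `B_r(μ, s̃)` (i.e. `d ≥ max B_r(μ, s̃)`) with
`B_r(μ, s̃) ∩ 𝟙_r = {t ∈ 𝟙_r : t ≤ d}`. -/
theorem Bset_inter_one_initial (e : ℤ) (he : 2 ≤ e) (r : ℕ) (hr : 2 ≤ r)
    (μ : Fin r → PartitionSeq) (hμ : ∀ i : ℕ, (μ ⟨0, by omega⟩).part i = 0) :
    ∃ N : ℕ, ∀ s : Fin r → ℤ,
      (∀ k : Fin r, k ≠ ⟨0, by omega⟩ → (N : ℤ) ≤ s ⟨0, by omega⟩ - s k) →
      ∃ d : ℤ, (∀ t ∈ Bset e r μ s, t ≤ d) ∧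
        Bset e r μ s ∩ {t : ℤ | bFun e (r : ℤ) t = 1} =
          {t : ℤ | bFun e (r : ℤ) t = 1 ∧ t ≤ d} := by
  have he0 : 0 < e := by omega
  have hr1 : (0 : ℤ) ≤ r - 1 := by omega
  have hc : 0 ≤ e * ((r : ℤ) - 1) := mul_nonneg he0.le hr1
  have hmono := strictMono_add_mul_ediv he0 hc
  refine ⟨(∑ k, (μ k).part 0) + e.toNat, fun s hs => ?_⟩
  set z : Fin r := ⟨0, by omega⟩ with hz
  have hzero (i : ℕ) : checkBeta e r μ s z i =
      (s z - i) + e * (r - 1) * ((s z - i - 1) / e) := by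
    rw [checkBeta_eq he0, hμ i]
    simp [hz]
  have hle : ∀ t ∈ Bset e r μ s, t ≤ s z + e * (r - 1) * ((s z - 1) / e) := by
    rintro _ ⟨⟨k, i⟩, rfl⟩
    dsimp only
    by_cases hk : k = z
    · rw [hk, hzero]
      exact hmono.monotone (show s z - i ≤ s z by omega)
    · have hpart : (μ k).part i ≤ ∑ k, (μ k).part 0 :=
        ((μ k).antitone' 0 i i.zero_le).trans
          (Finset.single_le_sum (f := fun k => (μ k).part 0) (fun _ _ => Nat.zero_le _)
            (Finset.mem_univ k))
      have hsk := hs k hk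
      have hβ : ((μ k).part i : ℤ) + s k - i ≤ s z - e := by omega
      have hkr : e * ((k : ℕ) : ℤ) ≤ e * (r - 1) :=
        mul_le_mul_of_nonneg_left (by omega) he0.le
      have hm := hmono.monotone hβ
      have hdiv : (s z - e - 1) / e = (s z - 1) / e - 1 := by
        rw [show s z - e - 1 = s z - 1 + e * (-1) by ring, Int.add_mul_ediv_left _ _ he0.ne']
        ring
      rw [checkBeta_eq he0]
      rw [hdiv] at hm
      linarith
  refine ⟨_, hle, Set.ext fun t => ⟨fun ⟨h, hb⟩ => ⟨hb, hle t h⟩, fun ⟨hb, ht⟩ => ⟨?_, hb⟩⟩⟩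
  obtain ⟨β, rfl⟩ := exists_add_mul_ediv_eq he0 (by omega) hb
  have hβ : β ≤ s z := hmono.le_iff_le.mp ht
  refine ⟨(z, (s z - β).toNat), ?_⟩
  dsimp only
  rw [hzero, Int.toNat_of_nonneg (by omega), sub_sub_cancel]

end
end

section
/- Let e ≥ 2 and r ≥ 2 be integers. Suppose c ≤ d are integers, let u_1 > … > u_n be the elements of {c, c+1, …, d} ∩ 𝟙_r in decreasing order, let v_1 > … > v_m be elements of {c, c+1, …, d} ∖ 𝟙_r, and let t_1 > … > t_{m+n} be the elements of {v_1,…,v_m} ∪ {u_1,…,u_n} in decreasing order. Then there exists a scalar α ∈ ℚ(q) such that, in the (m+n)-wedge space Λ^{m+n}_{e,r}, |t_{m+n}⟩∧|t_{m+n−1}⟩∧…∧|t_1⟩ = α · (|u_n⟩∧…∧|u_1⟩∧|v_m⟩∧…∧|v_1⟩). -/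
noncomputable section

/-- The `(m+n)`-tuple `(u_n, …, u_1, v_m, …, v_1)` (with `u` and `v` 0-based, so
`u_j` is `u (j-1)` and `v_j` is `v (j-1)`). -/
def concatRev (n m : ℕ) (u : Fin n → ℤ) (v : Fin m → ℤ) : Fin (m + n) → ℤ := fun i =>
  if h : (i : ℕ) < n then u ⟨n - 1 - (i : ℕ), by omega⟩
  else v ⟨m - 1 - ((i : ℕ) - n), by have := i.2; omega⟩

theorem qK_ne_zero : qK ≠ 0 := RatFunc.X_ne_zero

theorem bFun_decomp {e r a b : ℤ} (ha : 0 ≤ a) (hae : a < e) (hb : 0 ≤ b) (hbr : b < r) (k : ℤ) :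
    bFun e r (a + 1 + e * b + e * r * k) = b + 1 := by
  have he : 0 < e := by omega
  have h1 : a + 1 + e * b + e * r * k - 1 = (a + e * b) + e * r * k := by ring
  have h2 : (a + e * b) % (e * r) = a + e * b :=
    Int.emod_eq_of_lt (by positivity) (by nlinarith)
  rw [bFun, h1, Int.add_mul_emod_self_left, h2, Int.add_mul_ediv_left _ _ he.ne',
    Int.ediv_eq_zero_of_lt ha hae, zero_add]

theorem exists_decomp_s6 {e r : ℤ} (he : 0 < e) (hr : 0 < r) (x : ℤ) :
    ∃ a b k : ℤ, 0 ≤ a ∧ a < e ∧ 0 ≤ b ∧ b < r ∧ x = a + 1 + e * b + e * r * k ∧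
      aFun e x = a + 1 ∧ bFun e r x = b + 1 := by
  have hx : x = (x - 1) % e + 1 + e * ((x - 1) / e % r) + e * r * ((x - 1) / e / r) := by
    have h1 := Int.mul_ediv_add_emod (x - 1) e
    have h2 := Int.mul_ediv_add_emod ((x - 1) / e) r
    linear_combination -h1 - e * h2
  have ha := Int.emod_nonneg (x - 1) he.ne'
  have hae := Int.emod_lt_of_pos (x - 1) he
  have hb := Int.emod_nonneg ((x - 1) / e) hr.ne'
  have hbr := Int.emod_lt_of_pos ((x - 1) / e) hr
  refine ⟨_, _, _, ha, hae, hb, hbr, hx, rfl, ?_⟩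
  conv_lhs => rw [hx]
  exact bFun_decomp ha hae hb hbr _

/-- An integer with the same `a`-component as `y` and the same `b`-component as `x`, up to a
multiple of `e * r`, has the `b`-value of `x`. -/
theorem bFun_shift {e r : ℤ} (he : 0 < e) (hr : 0 < r) (x y z k : ℤ)
    (hz : z = aFun e y + e * (bFun e r x - 1) + e * r * k) : bFun e r z = bFun e r x := by
  obtain ⟨a, b, -, ha, hae, -, -, -, hay, -⟩ := exists_decomp_s6 he hr y
  obtain ⟨a', b', -, -, -, hb, hbr, -, -, hbx⟩ := exists_decomp_s6 he hr x
  rw [hz, hay, hbx]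
  refine Eq.trans (congrArg _ ?_) (bFun_decomp ha hae hb hbr k)
  ring

/-- The pairs which may occur as lower terms in the straightening of `|t⟩∧|u⟩`. -/
def lowerPairs (e r t u : ℤ) : Set (ℤ × ℤ) :=
  {p | t < p.2 ∧ p.2 < p.1 ∧ p.1 < u ∧
    ((bFun e r p.1 = bFun e r u ∧ bFun e r p.2 = bFun e r t) ∨
      (bFun e r p.1 = bFun e r t ∧ bFun e r p.2 = bFun e r u))}

/-- The span of the pairs belonging to a given set. -/
def pairSpan (T : Set (ℤ × ℤ)) : Submodule K ((ℤ × ℤ) →₀ K) :=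
  Submodule.span K ((fun p : ℤ × ℤ => pairTerm p.1 p.2) '' T)

theorem pairTerm_mem_pairSpan {T : Set (ℤ × ℤ)} {x y : ℤ} (h : (x, y) ∈ T) :
    pairTerm x y ∈ pairSpan T :=
  Submodule.subset_span ⟨(x, y), h, rfl⟩

theorem pairSum_mem_pairSpan {T : Set (ℤ × ℤ)} {N t u γ : ℤ} {m0 : ℕ} (coeff : ℕ → K)
    (h : ∀ m : ℕ, m0 ≤ m → t + γ + N * m < u - γ - N * m →
      (u - γ - N * m, t + γ + N * m) ∈ T) :
    pairSum N t u γ m0 coeff ∈ pairSpan T := by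
  refine Submodule.sum_mem _ fun m hm => ?_
  split_ifs with hlt
  · exact Submodule.smul_mem _ _ (pairTerm_mem_pairSpan (h m (Finset.mem_Ico.1 hm).1 hlt))
  · exact Submodule.zero_mem _

theorem exists_pairRHS_eq {e r : ℤ} (he : 0 < e) (hr : 0 < r) (t u : ℤ) :
    ∃ k : K, k ≠ 0 ∧ ∃ y ∈ pairSpan (lowerPairs e r t u),
      pairRHS e r t u = k • pairTerm u t + y := by
  have hN : 0 < e * r := mul_pos he hr
  obtain ⟨at', bt, kt, -, -, -, -, hst, hat, hbt⟩ := exists_decomp_s6 he hr t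
  obtain ⟨au, bu, ku, -, -, -, -, hsu, hau, hbu⟩ := exists_decomp_s6 he hr u
  set α := (aFun e u - aFun e t) % (e * r) with hα
  set β := (e * (bFun e r u - bFun e r t)) % (e * r) with hβ
  have hα0 : 0 ≤ α := Int.emod_nonneg _ hN.ne'
  have hβ0 : 0 ≤ β := Int.emod_nonneg _ hN.ne'
  have hα1 := Int.mul_ediv_add_emod (aFun e u - aFun e t) (e * r)
  have hβ1 := Int.mul_ediv_add_emod (e * (bFun e r u - bFun e r t)) (e * r)
  rw [← hα] at hα1
  rw [← hβ] at hβ1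
  set i := (aFun e u - aFun e t) / (e * r)
  set j := (e * (bFun e r u - bFun e r t)) / (e * r)
  have s0 (c : ℕ → K) : pairSum (e * r) t u 0 1 c ∈ pairSpan (lowerPairs e r t u) := by
    refine pairSum_mem_pairSpan c fun m hm hlt => ?_
    have hm' : 0 < e * r * (m : ℤ) := mul_pos hN (by exact_mod_cast hm)
    refine ⟨by simp only; omega, hlt, by simp only; omega, Or.inl ⟨?_, ?_⟩⟩
    · refine bFun_shift he hr u u _ (ku - m) ?_
      rw [hau, hbu]; linear_combination hsu
    · refine bFun_shift he hr t t _ (kt + m) ?_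
      rw [hat, hbt]; linear_combination hst
  have sα (h : α ≠ 0) (c : ℕ → K) :
      pairSum (e * r) t u α 0 c ∈ pairSpan (lowerPairs e r t u) := by
    refine pairSum_mem_pairSpan c fun m hm hlt => ?_
    have hm' : 0 ≤ e * r * (m : ℤ) := mul_nonneg hN.le (by positivity)
    refine ⟨by simp only; omega, hlt, by simp only; omega, Or.inl ⟨?_, ?_⟩⟩
    · refine bFun_shift he hr u t _ (ku + i - m) ?_
      rw [hbu]; rw [hau] at hα1; linear_combination hsu - hα1
    · refine bFun_shift he hr t u _ (kt - i + m) ?_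
      rw [hbt]; rw [hat] at hα1; linear_combination hst + hα1
  have sβ (h : β ≠ 0) (c : ℕ → K) :
      pairSum (e * r) t u β 0 c ∈ pairSpan (lowerPairs e r t u) := by
    refine pairSum_mem_pairSpan c fun m hm hlt => ?_
    have hm' : 0 ≤ e * r * (m : ℤ) := mul_nonneg hN.le (by positivity)
    refine ⟨by simp only; omega, hlt, by simp only; omega, Or.inr ⟨?_, ?_⟩⟩
    · refine bFun_shift he hr t u _ (ku + j - m) ?_
      rw [hau]; rw [hbu] at hβ1; linear_combination hsu - hβ1
    · refine bFun_shift he hr u t _ (kt - j + m) ?_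
      rw [hat]; rw [hbt] at hβ1; linear_combination hst + hβ1
  have sαβ (h : β ≠ 0) (c : ℕ → K) :
      pairSum (e * r) t u (α + β) 0 c ∈ pairSpan (lowerPairs e r t u) := by
    refine pairSum_mem_pairSpan c fun m hm hlt => ?_
    have hm' : 0 ≤ e * r * (m : ℤ) := mul_nonneg hN.le (by positivity)
    refine ⟨by simp only; omega, hlt, by simp only; omega, Or.inr ⟨?_, ?_⟩⟩
    · refine bFun_shift he hr t t _ (ku + i + j - m) ?_
      rw [hau] at hα1; rw [hbu] at hβ1; linear_combination hsu - hβ1 - hα1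
    · refine bFun_shift he hr u u _ (kt - i - j + m) ?_
      rw [hat] at hα1; rw [hbt] at hβ1; linear_combination hst + hβ1 + hα1
  have hq := qK_ne_zero
  simp only [pairRHS, ← hα, ← hβ]
  by_cases hβz : β = 0 <;> by_cases hαz : α = 0
  · rw [if_pos ⟨hαz, hβz⟩]
    exact ⟨-1, by simp, 0, Submodule.zero_mem _, by simp⟩
  · rw [if_neg (by tauto), if_pos hβz]
    exact ⟨-qK⁻¹, by simpa using hq, _,
      Submodule.smul_mem _ _ (Submodule.sub_mem _ (sα hαz _) (s0 _)), by rw [neg_smul]⟩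
  · rw [if_neg (by tauto), if_neg hβz, if_pos hαz]
    exact ⟨-qK, by simpa using hq, _,
      Submodule.smul_mem _ _ (Submodule.sub_mem _ (sβ hβz _) (s0 _)), by rw [neg_smul]⟩
  · rw [if_neg (by tauto), if_neg hβz, if_neg hαz]
    simp only [add_assoc]
    exact ⟨-1, by simp, _, Submodule.add_mem _ (Submodule.smul_mem _ _ (sβ hβz _))
      (Submodule.add_mem _ (Submodule.smul_mem _ _ (sα hαz _)) (Submodule.add_mem _
      (Submodule.smul_mem _ _ (sαβ hβz _)) (Submodule.smul_mem _ _ (s0 _)))),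
      by rw [neg_smul, one_smul]⟩

/-- The span of the two-entry straightening relators. -/
def pairRel (e r : ℤ) : Submodule K ((ℤ × ℤ) →₀ K) :=
  Submodule.span K {x | ∃ t u : ℤ, t ≤ u ∧ x = pairTerm t u - pairRHS e r t u}

theorem pairSpan_mono {S T : Set (ℤ × ℤ)} (h : S ⊆ T) : pairSpan S ≤ pairSpan T :=
  Submodule.span_mono (Set.image_mono h)

theorem pairSpan_le {T : Set (ℤ × ℤ)} {M : Submodule K ((ℤ × ℤ) →₀ K)}
    (h : ∀ p ∈ T, pairTerm p.1 p.2 ∈ M) : pairSpan T ≤ M := by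
  rw [pairSpan, Submodule.span_le]
  rintro _ ⟨p, hp, rfl⟩
  exact h p hp

/-- Straightening `|t⟩∧|u⟩`, read modulo the lower terms. -/
theorem exists_pairTerm_sub_mem {e r : ℤ} (he : 0 < e) (hr : 0 < r) {t u : ℤ} (h : t ≤ u) :
    ∃ k : K, k ≠ 0 ∧
      pairTerm t u - k • pairTerm u t ∈ pairRel e r ⊔ pairSpan (lowerPairs e r t u) := by
  obtain ⟨k, hk, y, hy, heq⟩ := exists_pairRHS_eq he hr t u
  refine ⟨k, hk, ?_⟩
  have h1 : pairTerm t u - pairRHS e r t u ∈ pairRel e r := Submodule.subset_span ⟨t, u, h, rfl⟩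
  have h2 : pairTerm t u - k • pairTerm u t = (pairTerm t u - pairRHS e r t u) + y := by
    rw [heq]; abel
  rw [h2]
  exact Submodule.add_mem_sup h1 hy

theorem pairTerm_self_mem {e r : ℤ} (x : ℤ) : pairTerm x x ∈ pairRel e r := by
  have h1 : pairTerm x x - pairRHS e r x x ∈ pairRel e r :=
    Submodule.subset_span ⟨x, x, le_rfl, rfl⟩
  have h2 : pairRHS e r x x = -pairTerm x x := by simp [pairRHS]
  rw [h2, sub_neg_eq_add, ← two_smul K] at h1
  exact (Submodule.smul_mem_iff _ (two_ne_zero)).1 h1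

/-- Pairs in the interval `[lo, hi]` whose first entry only has `b = 1`. -/
def goodPairs (e r lo hi : ℤ) : Set (ℤ × ℤ) :=
  {p | (lo ≤ p.1 ∧ p.1 ≤ hi) ∧ (lo ≤ p.2 ∧ p.2 ≤ hi) ∧ bFun e r p.1 = 1 ∧ bFun e r p.2 ≠ 1}

theorem goodPairs_mono {e r lo hi lo' hi' : ℤ} (h : lo' ≤ lo) (h' : hi ≤ hi') :
    goodPairs e r lo hi ⊆ goodPairs e r lo' hi' := by
  rintro p ⟨h1, h2, h3⟩
  exact ⟨by omega, by omega, h3⟩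

theorem pairTerm_swap_mem {e r : ℤ} (he : 0 < e) (hr : 0 < r) (k : ℕ) (w x lo hi : ℤ)
    (hk : (x - w).natAbs ≤ k) (hw : lo ≤ w ∧ w ≤ hi) (hx : lo ≤ x ∧ x ≤ hi)
    (hbw : bFun e r w ≠ 1) (hbx : bFun e r x = 1) :
    pairTerm w x ∈ pairRel e r ⊔ pairSpan (goodPairs e r lo hi) := by
  induction k generalizing w x with
  | zero =>
    have : x = w := by omega
    exact absurd (this ▸ hbx) hbw
  | succ k ih =>
    have key (t u : ℤ) (htu : (t = w ∧ u = x) ∨ (t = x ∧ u = w)) :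
        pairSpan (lowerPairs e r t u) ≤ pairRel e r ⊔ pairSpan (goodPairs e r lo hi) := by
      refine pairSpan_le fun p hp => ?_
      obtain ⟨h1, h2, h3, h4⟩ := hp
      by_cases hp1 : bFun e r p.1 = 1
      · refine Submodule.mem_sup_right (pairTerm_mem_pairSpan ⟨?_, ?_, hp1, ?_⟩)
        · simp only; omega
        · simp only; omega
        · rcases htu with ⟨rfl, rfl⟩ | ⟨rfl, rfl⟩ <;> rcases h4 with h4 | h4 <;> simp only <;> omega
      · refine ih p.1 p.2 (by omega) (by omega) (by omega) hp1 ?_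
        rcases htu with ⟨rfl, rfl⟩ | ⟨rfl, rfl⟩ <;> rcases h4 with h4 | h4 <;> omega
    have hxw : pairTerm x w ∈ pairRel e r ⊔ pairSpan (goodPairs e r lo hi) :=
      Submodule.mem_sup_right (pairTerm_mem_pairSpan ⟨hx, hw, hbx, hbw⟩)
    rcases le_total w x with h | h
    · obtain ⟨c, -, hc⟩ := exists_pairTerm_sub_mem he hr h
      have := sup_le le_sup_left (key w x (Or.inl ⟨rfl, rfl⟩)) hc
      exact (Submodule.sub_mem_iff_left _ (Submodule.smul_mem _ _ hxw)).1 this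
    · obtain ⟨c, hc0, hc⟩ := exists_pairTerm_sub_mem he hr h
      have := sup_le le_sup_left (key x w (Or.inr ⟨rfl, rfl⟩)) hc
      exact (Submodule.smul_mem_iff _ hc0).1 ((Submodule.sub_mem_iff_right _ hxw).1 this)

/-- Exchanging `w < x`, where only `x` has `b = 1`: all corrections lie strictly in between. -/
theorem exists_pairTerm_exchange {e r : ℤ} (he : 0 < e) (hr : 0 < r) {w x : ℤ} (h : w < x)
    (hbw : bFun e r w ≠ 1) (hbx : bFun e r x = 1) :
    ∃ k : K, pairTerm w x - k • pairTerm x w ∈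
      pairRel e r ⊔ pairSpan (goodPairs e r (w + 1) (x - 1)) := by
  obtain ⟨k, -, hk⟩ := exists_pairTerm_sub_mem he hr h.le
  refine ⟨k, sup_le le_sup_left (pairSpan_le fun p hp => ?_) hk⟩
  obtain ⟨h1, h2, h3, h4⟩ := hp
  by_cases hp1 : bFun e r p.1 = 1
  · refine Submodule.mem_sup_right (pairTerm_mem_pairSpan ⟨?_, ?_, hp1, ?_⟩) <;> simp only <;> omega
  · exact pairTerm_swap_mem he hr _ p.1 p.2 _ _ le_rfl (by omega) (by omega) hp1 (by omega)

theorem pairTerm_mem_of_lt {e r : ℤ} (he : 0 < e) (hr : 0 < r) {x z : ℤ} (h : x < z)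
    (hbx : bFun e r x = 1) (hbz : bFun e r z = 1) :
    pairTerm z x ∈ pairRel e r ⊔ pairSpan {p | x ≤ p.1 ∧ p.1 < z ∧ bFun e r p.1 = 1} := by
  obtain ⟨k, hk0, hk⟩ := exists_pairTerm_sub_mem he hr h.le
  have hxz : pairTerm x z ∈
      pairRel e r ⊔ pairSpan {p | x ≤ p.1 ∧ p.1 < z ∧ bFun e r p.1 = 1} :=
    Submodule.mem_sup_right (pairTerm_mem_pairSpan ⟨le_rfl, h, hbx⟩)
  have hsub : lowerPairs e r x z ⊆ {p | x ≤ p.1 ∧ p.1 < z ∧ bFun e r p.1 = 1} := by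
    rintro p ⟨h1, h2, h3, h4⟩
    exact ⟨by omega, h3, by omega⟩
  have := sup_le_sup_left (pairSpan_mono hsub) _ hk
  exact (Submodule.smul_mem_iff _ hk0).1 ((Submodule.sub_mem_iff_right _ hxz).1 this)

/-- The wedge whose entries are the first `l` entries of a list (padded by zeros). -/
def listWedge (e r : ℤ) (l : ℕ) (L : List ℤ) : WedgeSpace e r l :=
  wedge e r l fun i => L.getD i 0

/-- Insertion of a two-entry wedge between two lists. -/
def insertPair (e r : ℤ) (l : ℕ) (A B : List ℤ) : ((ℤ × ℤ) →₀ K) →ₗ[K] WedgeSpace e r l :=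
  Finsupp.linearCombination K fun p => listWedge e r l (A ++ p.1 :: p.2 :: B)

theorem insertPair_pairTerm (e r : ℤ) (l : ℕ) (A B : List ℤ) (x y : ℤ) :
    insertPair e r l A B (pairTerm x y) = listWedge e r l (A ++ x :: y :: B) := by
  simp [insertPair, pairTerm]

theorem updPair_getD (l : ℕ) (A B : List ℤ) (t u : ℤ) (p : ℤ × ℤ) :
    updPair l (fun i : Fin l => (A ++ t :: u :: B).getD i 0) A.length p =
      fun i : Fin l => (A ++ p.1 :: p.2 :: B).getD i 0 := by
  funext i
  simp only [updPair]
  split_ifs with h1 h2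
  · simp [h1]
  · rw [h2, List.getD_append_right _ _ _ _ (by omega)]
    simp
  · rcases lt_or_ge (i : ℕ) A.length with h | h
    · rw [List.getD_append _ _ _ _ h, List.getD_append _ _ _ _ h]
    · rw [List.getD_append_right _ _ _ _ h, List.getD_append_right _ _ _ _ h]
      obtain ⟨k, hk⟩ : ∃ k, (i : ℕ) - A.length = k + 2 := ⟨i - A.length - 2, by omega⟩
      simp [hk]

theorem pairRel_le_ker {e r : ℤ} {l : ℕ} {A : List ℤ} (B : List ℤ) (h : A.length + 2 ≤ l) :
    pairRel e r ≤ LinearMap.ker (insertPair e r l A B) := by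
  rw [pairRel, Submodule.span_le]
  rintro _ ⟨t, u, htu, rfl⟩
  rw [SetLike.mem_coe, LinearMap.mem_ker, map_sub, insertPair_pairTerm, insertPair,
    Finsupp.linearCombination_apply]
  have hmem : Finsupp.single (fun i : Fin l => (A ++ t :: u :: B).getD i 0) (1 : K) -
      (pairRHS e r t u).sum (fun p c =>
        Finsupp.single (fun i : Fin l => (A ++ p.1 :: p.2 :: B).getD i 0) c) ∈ relSet e r l := by
    refine ⟨fun i => (A ++ t :: u :: B).getD i 0, ⟨A.length, by omega⟩,
      ⟨A.length + 1, by omega⟩, rfl, ?_, ?_⟩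
    · simpa [List.getD_append_right] using htu
    · simp only [updPair_getD]
      congr 2
      simp
  have h0 := (Submodule.Quotient.mk_eq_zero _).2
    (Submodule.subset_span (R := K) hmem)
  rw [Submodule.Quotient.mk_sub] at h0
  rw [← h0]
  congr 1
  rw [← Submodule.mkQ_apply, map_finsuppSum]
  refine Finsupp.sum_congr fun p _ => ?_
  rw [listWedge, wedge, ← Submodule.mkQ_apply, ← map_smul, Finsupp.smul_single, smul_eq_mul,
    mul_one]

theorem insertPair_eq_zero {e r : ℤ} {l : ℕ} {A B : List ℤ} (h : A.length + 2 ≤ l)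
    {T : Set (ℤ × ℤ)} (hT : ∀ p ∈ T, listWedge e r l (A ++ p.1 :: p.2 :: B) = 0)
    {z : (ℤ × ℤ) →₀ K} (hz : z ∈ pairRel e r ⊔ pairSpan T) : insertPair e r l A B z = 0 := by
  refine LinearMap.mem_ker.1 (sup_le (pairRel_le_ker B h) (pairSpan_le fun p hp => ?_) hz)
  rw [LinearMap.mem_ker, insertPair_pairTerm, hT p hp]

/-- `s` lists in increasing order the integers in `[c, d)` with `b = 1`. -/
def IsFullList (e r c d : ℤ) (s : List ℤ) : Prop :=
  s.Pairwise (· < ·) ∧ ∀ y, y ∈ s ↔ bFun e r y = 1 ∧ c ≤ y ∧ y < d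

theorem listWedge_full_append_mem {e r : ℤ} (he : 0 < e) (hr : 0 < r) {l : ℕ} {c d : ℤ}
    {s : List ℤ} (hs : IsFullList e r c d s) (hl : s.length + 1 ≤ l) {x : ℤ} (hx : x ∈ s)
    (R : List ℤ) : listWedge e r l (s ++ x :: R) = 0 := by
  induction s using List.reverseRecOn generalizing d x R with
  | nil => simp at hx
  | append_singleton s z ih =>
    obtain ⟨hp, hm⟩ := hs
    have hz := (hm z).1 (by simp)
    have hlt : ∀ y ∈ s, y < z := fun y hy => by
      simpa using (List.pairwise_append.1 hp).2.2 y hy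
    have hfull : IsFullList e r c z s := by
      refine ⟨(List.pairwise_append.1 hp).1, fun y => ⟨fun hy => ?_, fun hy => ?_⟩⟩
      · have := (hm y).1 (by simp [hy])
        exact ⟨this.1, this.2.1, hlt y hy⟩
      · have := (hm y).2 ⟨hy.1, hy.2.1, by omega⟩
        rw [List.mem_append, List.mem_singleton] at this
        exact this.resolve_right (by omega)
    rw [List.length_append, List.length_singleton] at hl
    rw [List.append_assoc, List.singleton_append, ← insertPair_pairTerm]
    rw [List.mem_append, List.mem_singleton] at hx
    rcases hx with hx | rfl
    · have hbx := (hfull.2 x).1 hx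
      refine insertPair_eq_zero hl (fun p hp => ?_)
        (pairTerm_mem_of_lt he hr (hlt x hx) hbx.1 hz.1)
      exact ih hfull (by omega) ((hfull.2 _).2 ⟨hp.2.2, hbx.2.1.trans hp.1, hp.2.1⟩) _
    · exact insertPair_eq_zero (T := ∅) hl (by simp) (Submodule.mem_sup_left (pairTerm_self_mem x))

theorem listWedge_full_append_append_mem {e r : ℤ} (he : 0 < e) (hr : 0 < r) {l : ℕ} {c d : ℤ}
    {s : List ℤ} (hs : IsFullList e r c d s) {W : List ℤ}
    (hW : ∀ w ∈ W, bFun e r w ≠ 1 ∧ c ≤ w ∧ w < d) (hl : s.length + W.length + 1 ≤ l) {x : ℤ}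
    (hx : x ∈ s) (R : List ℤ) : listWedge e r l (s ++ W ++ x :: R) = 0 := by
  induction W using List.reverseRecOn generalizing x R with
  | nil => simpa using listWedge_full_append_mem he hr hs (by simpa using hl) hx R
  | append_singleton W w ih =>
    rw [List.length_append, List.length_singleton] at hl
    have hw := hW w (by simp)
    have hbx := (hs.2 x).1 hx
    rw [← List.append_assoc, List.append_assoc _ [w], List.singleton_append,
      ← insertPair_pairTerm]
    refine insertPair_eq_zero (by rw [List.length_append]; omega) (fun p hp => ?_)
      (pairTerm_swap_mem he hr _ w x c (d - 1) le_rfl (by omega) (by omega) hw.1 hbx.1)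
    exact ih (fun w hw => hW w (by simp [hw])) (by omega)
      ((hs.2 _).2 ⟨hp.2.2.1, hp.1.1, by have := hp.1.2; omega⟩) _

theorem exists_listWedge_move {e r : ℤ} (he : 0 < e) (hr : 0 < r) {l : ℕ} {c x : ℤ}
    {s : List ℤ} (hs : IsFullList e r c x s) (hbx : bFun e r x = 1) {W : List ℤ}
    (hW : ∀ w ∈ W, bFun e r w ≠ 1 ∧ c ≤ w ∧ w < x) (hl : s.length + W.length + 1 ≤ l)
    (R : List ℤ) :
    ∃ α : K, listWedge e r l (s ++ W ++ x :: R) = α • listWedge e r l (s ++ x :: W ++ R) := by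
  induction W using List.reverseRecOn generalizing R with
  | nil => exact ⟨1, by simp⟩
  | append_singleton W w ih =>
    rw [List.length_append, List.length_singleton] at hl
    have hw := hW w (by simp)
    have hW' : ∀ w ∈ W, bFun e r w ≠ 1 ∧ c ≤ w ∧ w < x := fun w hw => hW w (by simp [hw])
    obtain ⟨k, hk⟩ := exists_pairTerm_exchange he hr hw.2.2 hw.1 hbx
    have h0 : insertPair e r l (s ++ W) R (pairTerm w x - k • pairTerm x w) = 0 := by
      refine insertPair_eq_zero (by rw [List.length_append]; omega) (fun p hp => ?_) hk
      have := hp.1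
      exact listWedge_full_append_append_mem he hr hs hW' (by omega)
        ((hs.2 _).2 ⟨hp.2.2.1, by omega, by omega⟩) _
    obtain ⟨α, hα⟩ := ih hW' (by omega) (w :: R)
    refine ⟨k * α, ?_⟩
    rw [map_sub, map_smul, insertPair_pairTerm, insertPair_pairTerm, sub_eq_zero, hα,
      smul_smul] at h0
    simpa using h0

theorem exists_listWedge_filter {e r : ℤ} (he : 0 < e) (hr : 0 < r) {l : ℕ} {c : ℤ} {L : List ℤ}
    (hL : L.Pairwise (· < ·)) (hc : ∀ x ∈ L, c ≤ x)
    (hfull : ∀ x ∈ L, ∀ y, bFun e r y = 1 → c ≤ y → y ≤ x → y ∈ L) (hl : L.length ≤ l)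
    (R : List ℤ) :
    ∃ α : K, listWedge e r l (L ++ R) = α • listWedge e r l
      (L.filter (bFun e r · = 1) ++ L.filter (bFun e r · ≠ 1) ++ R) := by
  induction L using List.reverseRecOn generalizing R with
  | nil => exact ⟨1, by simp⟩
  | append_singleton L x ih =>
    rw [List.length_append, List.length_singleton] at hl
    have hlt : ∀ y ∈ L, y < x := fun y hy => by
      simpa using (List.pairwise_append.1 hL).2.2 y hy
    have hx : c ≤ x := hc x (by simp)
    have hmem : ∀ y, bFun e r y = 1 → c ≤ y → y < x → y ∈ L := fun y h1 h2 h3 => by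
      have := hfull x (by simp) y h1 h2 h3.le
      rw [List.mem_append, List.mem_singleton] at this
      exact this.resolve_right (by omega)
    have hp := (List.pairwise_append.1 hL).1
    obtain ⟨α, hα⟩ := ih hp (fun y hy => hc y (by simp [hy]))
      (fun y hy z h1 h2 h3 => hmem z h1 h2 (h3.trans_lt (hlt y hy))) (by omega) (x :: R)
    by_cases hbx : bFun e r x = 1
    · have hs : IsFullList e r c x (L.filter (bFun e r · = 1)) := by
        refine ⟨hp.filter _, fun y => ?_⟩
        rw [List.mem_filter, decide_eq_true_eq]
        exact ⟨fun h => ⟨h.2, hc y (by simp [h.1]), hlt y h.1⟩,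
          fun h => ⟨hmem y h.1 h.2.1 h.2.2, h.1⟩⟩
      have hlen := L.length_eq_length_filter_add (bFun e r · = 1)
      obtain ⟨β, hβ⟩ := exists_listWedge_move he hr (l := l) hs hbx
        (W := L.filter (bFun e r · ≠ 1))
        (fun w hw => by
          rw [List.mem_filter, decide_eq_true_eq] at hw
          exact ⟨hw.2, hc w (by simp [hw.1]), hlt w hw.1⟩)
        (by simp only [ne_eq, decide_not]; omega) R
      refine ⟨α * β, ?_⟩
      rw [List.append_assoc, List.singleton_append, hα, hβ, smul_smul]
      simp [hbx]
    · refine ⟨α, ?_⟩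
      rw [List.append_assoc, List.singleton_append, hα]
      simp [hbx]

theorem List.eq_of_pairwise_lt_of_mem_iff {L L' : List ℤ} (h : L.Pairwise (· < ·))
    (h' : L'.Pairwise (· < ·)) (hm : ∀ x, x ∈ L ↔ x ∈ L') : L = L' :=
  ((List.perm_ext_iff_of_nodup (h.imp ne_of_lt) (h'.imp ne_of_lt)).2 hm).eq_of_pairwise
    (fun _ _ _ _ h1 h2 => absurd h1 h2.not_gt) h h'

theorem pairwise_ofFn_rev {n : ℕ} {u : Fin n → ℤ} (hu : StrictAnti u) :
    (List.ofFn fun i => u i.rev).Pairwise (· < ·) :=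
  List.pairwise_ofFn.2 fun _ _ h => hu (Fin.rev_lt_rev.2 h)

theorem mem_ofFn_rev {n : ℕ} {u : Fin n → ℤ} {x : ℤ} :
    x ∈ (List.ofFn fun i => u i.rev) ↔ x ∈ Set.range u := by
  rw [List.mem_ofFn', Set.mem_range, Set.mem_range]
  exact ⟨fun ⟨i, h⟩ => ⟨_, h⟩, fun ⟨i, h⟩ => ⟨i.rev, by simpa using h⟩⟩

theorem concatRev_eq_getD (n m : ℕ) (u : Fin n → ℤ) (v : Fin m → ℤ) :
    concatRev n m u v = fun i : Fin (m + n) =>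
      ((List.ofFn fun i => u i.rev) ++ List.ofFn fun i => v i.rev).getD i 0 := by
  funext i
  have hi := i.2
  simp only [concatRev]
  split_ifs with h
  · rw [List.getD_append _ _ _ _ (by simpa using h), List.getD_eq_getElem _ _ (by simpa using h),
      List.getElem_ofFn]
    congr 1
    ext
    simp only [Fin.val_rev]
    omega
  · rw [List.getD_append_right _ _ _ _ (by simpa using h), List.length_ofFn,
      List.getD_eq_getElem _ _ (by simp; omega), List.getElem_ofFn]
    congr 1
    ext
    simp only [Fin.val_rev]
    omega

/-- With `u₁ > … > u_n` the elements of `{c,…,d} ∩ 𝟙_r`,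
`v₁ > … > v_m` elements of `{c,…,d} ∖ 𝟙_r`, and `t₁ > … > t_{m+n}` the elements of
`{v₁,…,v_m} ∪ {u₁,…,u_n}`, the wedge `|t_{m+n}⟩∧…∧|t₁⟩` is a scalar multiple of
`|u_n⟩∧…∧|u₁⟩∧|v_m⟩∧…∧|v₁⟩` in `Λ^{m+n}_{e,r}`. -/
theorem reversed_wedge_proportional (e r : ℤ) (he : 2 ≤ e) (hr : 2 ≤ r)
    (c d : ℤ) (hcd : c ≤ d) (n m : ℕ)
    (u : Fin n → ℤ) (hu : StrictAnti u)
    (huset : Set.range u = {x : ℤ | x ∈ Set.Icc c d ∧ bFun e r x = 1})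
    (v : Fin m → ℤ) (hv : StrictAnti v)
    (hvmem : ∀ i, v i ∈ Set.Icc c d ∧ bFun e r (v i) ≠ 1)
    (t : Fin (m + n) → ℤ) (ht : StrictAnti t)
    (htset : Set.range t = Set.range v ∪ Set.range u) :
    ∃ α : K, wedge e r (m + n) (fun i => t i.rev) =
      α • wedge e r (m + n) (concatRev n m u v) := by
  have hp := pairwise_ofFn_rev ht
  have hmem : ∀ x, x ∈ (List.ofFn fun i => t i.rev) ↔
      x ∈ Set.range v ∨ (x ∈ Set.Icc c d ∧ bFun e r x = 1) := fun x => by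
    rw [mem_ofFn_rev, htset, huset, Set.mem_union, Set.mem_ofPred_eq]
  have hv' : ∀ x ∈ Set.range v, x ∈ Set.Icc c d ∧ bFun e r x ≠ 1 := by
    rintro _ ⟨i, rfl⟩
    exact hvmem i
  have hIcc : ∀ x ∈ (List.ofFn fun i => t i.rev), x ∈ Set.Icc c d := fun x hx =>
    ((hmem x).1 hx).elim (fun h => (hv' x h).1) fun h => h.1
  obtain ⟨α, hα⟩ := exists_listWedge_filter (e := e) (r := r) (by omega) (by omega)
    (l := m + n) hp (fun x hx => (hIcc x hx).1)
    (fun x hx y h1 h2 h3 => (hmem y).2 (Or.inr ⟨⟨h2, h3.trans (hIcc x hx).2⟩, h1⟩)) (by simp) []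
  have hfu : (List.ofFn fun i => t i.rev).filter (bFun e r · = 1) =
      List.ofFn fun i => u i.rev := by
    refine List.eq_of_pairwise_lt_of_mem_iff (hp.filter _) (pairwise_ofFn_rev hu) fun x => ?_
    rw [List.mem_filter, hmem, mem_ofFn_rev, huset, decide_eq_true_eq, Set.mem_ofPred_eq]
    have := hv' x
    tauto
  have hfv : (List.ofFn fun i => t i.rev).filter (bFun e r · ≠ 1) =
      List.ofFn fun i => v i.rev := by
    refine List.eq_of_pairwise_lt_of_mem_iff (hp.filter _) (pairwise_ofFn_rev hv) fun x => ?_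
    rw [List.mem_filter, hmem, mem_ofFn_rev, decide_eq_true_eq]
    have := hv' x
    tauto
  refine ⟨α, ?_⟩
  rw [hfu, hfv, List.append_nil, List.append_nil, listWedge, listWedge,
    ← concatRev_eq_getD] at hα
  rw [← hα]
  congr 1
  funext i
  rw [List.getD_eq_getElem _ _ (by simp), List.getElem_ofFn]

end
end
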